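/- Let n ≥ 2 and let F = α + β be a Randers metric on a nonempty open set U ⊆ ℝⁿ. If F is of weakly isotropic scalar curvature, i.e. its Akbar-Zadeh scalar curvature satisfies r(x,y) = n(n−1)(θ(x,y)/F(x,y) + μ(x)) for some smooth 1-form θ = θ_i(x)y^i and smooth function μ on U, then F is of isotropic S-curvature: there exists a smooth function c : U → ℝ such that S(x,y) = (n+1) c(x) F(x,y) for all (x,y) ∈ U × (ℝⁿ \ {0}). -/

import Mathlib

open MeasureTheory Matrix

noncomputable section

/-- `Vec n` is ℝⁿ. -/
abbrev Vec (n : ℕ) := Fin n → ℝ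

/-- Partial derivative of `f` in the `i`-th coordinate direction at `x`. -/
noncomputable def pd {n : ℕ} (i : Fin n) (f : Vec n → ℝ) (x : Vec n) : ℝ :=
  fderiv ℝ f x (Pi.single i 1)

/-- Partial derivative in the `i`-th `y`-coordinate of a function of `(x, y)`. -/
noncomputable def dy {n : ℕ} (i : Fin n) (f : Vec n → Vec n → ℝ) (x y : Vec n) : ℝ :=
  pd i (f x) y

/-- Partial derivative in the `i`-th `x`-coordinate of a function of `(x, y)`. -/
noncomputable def dx {n : ℕ} (i : Fin n) (f : Vec n → Vec n → ℝ) (x y : Vec n) : ℝ :=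
  pd i (fun x' => f x' y) x

/-- The square `F²` of a metric function. -/
noncomputable def F2 {n : ℕ} (F : Vec n → Vec n → ℝ) : Vec n → Vec n → ℝ :=
  fun x y => (F x y) ^ 2

/-- The fundamental tensor `g_{ij}(x,y) = ½ ∂²(F²)/∂yⁱ∂yʲ`. -/
noncomputable def gmat {n : ℕ} (F : Vec n → Vec n → ℝ) (x y : Vec n) :
    Matrix (Fin n) (Fin n) ℝ :=
  Matrix.of fun i j => (1 / 2) * dy i (fun x' y' => dy j (F2 F) x' y') x y

/-- The inverse fundamental tensor `(g^{ij})`. -/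
noncomputable def ginv {n : ℕ} (F : Vec n → Vec n → ℝ) (x y : Vec n) :
    Matrix (Fin n) (Fin n) ℝ :=
  (gmat F x y)⁻¹

/-- The geodesic coefficients
`Gⁱ = ¼ g^{il} (∂²(F²)/∂x^m∂y^l · y^m − ∂(F²)/∂x^l)`. -/
noncomputable def Geo {n : ℕ} (F : Vec n → Vec n → ℝ) (i : Fin n) (x y : Vec n) : ℝ :=
  (1 / 4) * ∑ l, ginv F x y i l *
    ((∑ m, dx m (fun x' y' => dy l (F2 F) x' y') x y * y m) - dx l (F2 F) x y)

/-- The Riemann curvature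
`Rⁱ_k = 2 ∂Gⁱ/∂x^k − ∂²Gⁱ/∂x^j∂y^k y^j + 2 G^j ∂²Gⁱ/∂y^j∂y^k − ∂Gⁱ/∂y^j ∂G^j/∂y^k`. -/
noncomputable def Riem {n : ℕ} (F : Vec n → Vec n → ℝ) (i k : Fin n) (x y : Vec n) : ℝ :=
  2 * dx k (Geo F i) x y
    - (∑ j, dy k (fun x' y' => dx j (Geo F i) x' y') x y * y j)
    + 2 * ∑ j, Geo F j x y * dy j (fun x' y' => dy k (Geo F i) x' y') x y
    - ∑ j, dy j (Geo F i) x y * dy k (Geo F j) x y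

/-- The Ricci curvature `Ric = R^m_m`. -/
noncomputable def RicciC {n : ℕ} (F : Vec n → Vec n → ℝ) (x y : Vec n) : ℝ :=
  ∑ m, Riem F m m x y

/-- The Ricci curvature tensor `Ric_{ij} = ½ ∂²Ric/∂yⁱ∂yʲ`. -/
noncomputable def RicciTensor {n : ℕ} (F : Vec n → Vec n → ℝ) (i j : Fin n)
    (x y : Vec n) : ℝ :=
  (1 / 2) * dy i (fun x' y' => dy j (RicciC F) x' y') x y

/-- The Akbar-Zadeh scalar curvature `r = g^{ij} Ric_{ij}`. -/
noncomputable def scalarCurv {n : ℕ} (F : Vec n → Vec n → ℝ) (x y : Vec n) : ℝ :=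
  ∑ i, ∑ j, ginv F x y i j * RicciTensor F i j x y

/-- The Busemann-Hausdorff volume coefficient
`σ_BH(x) = Vol(𝔹ⁿ) / Vol {y | F(x,y) < 1}`. -/
noncomputable def sigmaBH {n : ℕ} (F : Vec n → Vec n → ℝ) (x : Vec n) : ℝ :=
  (volume {y : Vec n | ∑ i, (y i) ^ 2 < 1}).toReal /
    (volume {y : Vec n | F x y < 1}).toReal

/-- The S-curvature `S(x,y) = ∂G^m/∂y^m − y^m ∂/∂x^m (ln σ_BH)`. -/
noncomputable def SCurv {n : ℕ} (F : Vec n → Vec n → ℝ) (x y : Vec n) : ℝ :=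
  (∑ m, dy m (Geo F m) x y) - ∑ m, y m * pd m (fun x' => Real.log (sigmaBH F x')) x

/-- `F` is a Finsler metric on the open set `U ⊆ ℝⁿ`: it is smooth and positive on
`U × (ℝⁿ \ {0})`, positively 1-homogeneous in `y`, and its fundamental tensor is
positive definite. -/
def IsFinslerOn {n : ℕ} (F : Vec n → Vec n → ℝ) (U : Set (Vec n)) : Prop :=
  ContDiffOn ℝ (⊤ : ℕ∞) (fun p : Vec n × Vec n => F p.1 p.2)
    (U ×ˢ {y : Vec n | y ≠ 0}) ∧
  ∀ x ∈ U, ∀ y : Vec n, y ≠ 0 →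
    0 < F x y ∧ (∀ t : ℝ, 0 < t → F x (t • y) = t * F x y) ∧ (gmat F x y).PosDef

/-- The Riemannian part `α(x,y) = √(a_{ij}(x) yⁱ yʲ)` of a Randers metric. -/
noncomputable def ralpha {n : ℕ} (a : Vec n → Matrix (Fin n) (Fin n) ℝ)
    (x y : Vec n) : ℝ :=
  Real.sqrt (∑ i, ∑ j, a x i j * y i * y j)

/-- The 1-form part `β(x,y) = b_i(x) yⁱ` of a Randers metric. -/
noncomputable def rbeta {n : ℕ} (b : Vec n → Vec n) (x y : Vec n) : ℝ :=
  ∑ i, b x i * y i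

/-- `b(x)² = a^{ij}(x) b_i(x) b_j(x)`, the square of the α-norm of β. -/
noncomputable def bnormsq {n : ℕ} (a : Vec n → Matrix (Fin n) (Fin n) ℝ)
    (b : Vec n → Vec n) (x : Vec n) : ℝ :=
  ∑ i, ∑ j, (a x)⁻¹ i j * b x i * b x j

/-- The data `(a, b)` defines a Randers metric `F = α + β` on `U`:
`a` is a smooth field of symmetric positive definite matrices, `b` is a smooth
field of covectors with `‖β‖_α < 1`, and `F = α + β` is a Finsler metric on `U`. -/
def IsRandersOn {n : ℕ} (a : Vec n → Matrix (Fin n) (Fin n) ℝ) (b : Vec n → Vec n)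
    (U : Set (Vec n)) : Prop :=
  (∀ i j, ContDiffOn ℝ (⊤ : ℕ∞) (fun x => a x i j) U) ∧
  ContDiffOn ℝ (⊤ : ℕ∞) b U ∧
  (∀ x ∈ U, (a x).IsSymm ∧ (a x).PosDef ∧ bnormsq a b x < 1) ∧
  IsFinslerOn (fun x y => ralpha a x y + rbeta b x y) U

open scoped ContDiff

section calcs
variable {n : ℕ}

lemma pd_congr {f g : Vec n → ℝ} {x : Vec n} (i : Fin n) (h : f =ᶠ[nhds x] g) :
    pd i f x = pd i g x := by
  unfold pd; rw [h.fderiv_eq]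

lemma pd_add {f g : Vec n → ℝ} {x : Vec n} (i : Fin n) (hf : DifferentiableAt ℝ f x)
    (hg : DifferentiableAt ℝ g x) : pd i (fun z => f z + g z) x = pd i f x + pd i g x := by
  unfold pd; rw [fderiv_fun_add hf hg]; rfl

lemma pd_mul {f g : Vec n → ℝ} {x : Vec n} (i : Fin n) (hf : DifferentiableAt ℝ f x)
    (hg : DifferentiableAt ℝ g x) :
    pd i (fun z => f z * g z) x = pd i f x * g x + f x * pd i g x := by
  unfold pd; rw [fderiv_fun_mul hf hg]
  simp; ring

lemma pd_const (c : ℝ) (x : Vec n) (i : Fin n) : pd i (fun _ => c) x = 0 := by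
  unfold pd; simp

lemma pd_coord (x : Vec n) (i j : Fin n) :
    pd i (fun z : Vec n => z j) x = if j = i then 1 else 0 := by
  unfold pd
  have : HasFDerivAt (fun z : Vec n => z j) (ContinuousLinearMap.proj (R := ℝ) j) x :=
    (ContinuousLinearMap.proj (R := ℝ) (φ := fun _ : Fin n => ℝ) j).hasFDerivAt
  rw [this.fderiv]
  simp [Pi.single_apply]

lemma pd_comp {f : Vec n → ℝ} {g : ℝ → ℝ} {g' : ℝ} {x : Vec n} (i : Fin n)
    (hf : DifferentiableAt ℝ f x) (hg : HasDerivAt g g' (f x)) :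
    pd i (fun z => g (f z)) x = g' * pd i f x := by
  unfold pd
  have := hg.comp_hasFDerivAt x hf.hasFDerivAt
  have h2 : HasFDerivAt (fun z => g (f z)) (g' • fderiv ℝ f x) x := this
  rw [h2.fderiv]; simp

lemma pd_sum {ι : Type*} (s : Finset ι) {f : ι → Vec n → ℝ} {x : Vec n} (i : Fin n)
    (hf : ∀ j ∈ s, DifferentiableAt ℝ (f j) x) :
    pd i (fun z => ∑ j ∈ s, f j z) x = ∑ j ∈ s, pd i (f j) x := by
  unfold pd; rw [fderiv_fun_sum hf]; simp

lemma pd_smooth {f : Vec n → ℝ} {U : Set (Vec n)} (hU : IsOpen U)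
    (hf : ContDiffOn ℝ ∞ f U) (i : Fin n) : ContDiffOn ℝ ∞ (pd i f) U := by
  have : ContDiffOn ℝ ∞ (fun x => fderiv ℝ f x) U := hf.fderiv_of_isOpen hU (by simp)
  exact this.clm_apply contDiffOn_const

/-- jointly smooth on the domain -/
def Sm (U : Set (Vec n)) (f : Vec n → Vec n → ℝ) : Prop :=
  ContDiffOn ℝ ∞ (fun p : Vec n × Vec n => f p.1 p.2) (U ×ˢ {y : Vec n | y ≠ 0})

lemma isOpen_ne0 : IsOpen {y : Vec n | y ≠ 0} := isOpen_ne

lemma Sm.diffx {U : Set (Vec n)} (hU : IsOpen U) {f : Vec n → Vec n → ℝ} (hf : Sm U f)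
    {x y : Vec n} (hx : x ∈ U) (hy : y ≠ 0) : DifferentiableAt ℝ (fun x' => f x' y) x := by
  have h1 : DifferentiableAt ℝ (fun p : Vec n × Vec n => f p.1 p.2) (x, y) :=
    ((hf (x, y) ⟨hx, hy⟩).contDiffAt ((hU.prod isOpen_ne0).mem_nhds ⟨hx, hy⟩)).differentiableAt
      (by simp)
  exact h1.comp (f := fun x' : Vec n => (x', y)) x (by fun_prop)

lemma Sm.diffy {U : Set (Vec n)} (hU : IsOpen U) {f : Vec n → Vec n → ℝ} (hf : Sm U f)
    {x y : Vec n} (hx : x ∈ U) (hy : y ≠ 0) : DifferentiableAt ℝ (f x) y := by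
  have h1 : DifferentiableAt ℝ (fun p : Vec n × Vec n => f p.1 p.2) (x, y) :=
    ((hf (x, y) ⟨hx, hy⟩).contDiffAt ((hU.prod isOpen_ne0).mem_nhds ⟨hx, hy⟩)).differentiableAt
      (by simp)
  exact h1.comp (f := fun y' : Vec n => (x, y')) y (by fun_prop)

/-- equality on the domain -/
def EqD (U : Set (Vec n)) (f g : Vec n → Vec n → ℝ) : Prop :=
  ∀ x ∈ U, ∀ y, y ≠ 0 → f x y = g x y

variable {U : Set (Vec n)} {f g : Vec n → Vec n → ℝ}

lemma EqD.dx (hU : IsOpen U) (h : EqD U f g) (i : Fin n) : EqD U (dx i f) (dx i g) := by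
  intro x hx y hy
  exact pd_congr i (by filter_upwards [hU.mem_nhds hx] with z hz using h z hz y hy)

lemma EqD.dy (h : EqD U f g) (i : Fin n) : EqD U (dy i f) (dy i g) := by
  intro x hx y hy
  exact pd_congr i (by filter_upwards [isOpen_ne0.mem_nhds hy] with z hz using h x hx z hz)

lemma EqD.symm (h : EqD U f g) : EqD U g f := fun x hx y hy => (h x hx y hy).symm
lemma EqD.trans {k : Vec n → Vec n → ℝ} (h : EqD U f g) (h' : EqD U g k) : EqD U f k :=
  fun x hx y hy => (h x hx y hy).trans (h' x hx y hy)

lemma Sm.congr (h : Sm U f) (e : EqD U f g) : Sm U g :=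
  ContDiffOn.congr h (fun p hp => (e p.1 hp.1 p.2 hp.2).symm)
lemma Sm.add (hf : Sm U f) (hg : Sm U g) : Sm U (fun x y => f x y + g x y) := ContDiffOn.add hf hg
lemma Sm.mul (hf : Sm U f) (hg : Sm U g) : Sm U (fun x y => f x y * g x y) := ContDiffOn.mul hf hg
lemma Sm.coef {c : Vec n → ℝ} (hc : ContDiffOn ℝ ∞ c U) : Sm U (fun x _ => c x) :=
  ContDiffOn.comp hc contDiffOn_fst (fun p hp => hp.1)
lemma Sm.yc (i : Fin n) : Sm U (fun _ y => y i) := by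
  unfold Sm; fun_prop
lemma Sm.sum {ι : Type*} (s : Finset ι) {f : ι → Vec n → Vec n → ℝ} (h : ∀ i ∈ s, Sm U (f i)) :
    Sm U (fun x y => ∑ i ∈ s, f i x y) := ContDiffOn.sum h

lemma dx_add (hU : IsOpen U) (hf : Sm U f) (hg : Sm U g) (i : Fin n) :
    EqD U (dx i (fun x y => f x y + g x y)) (fun x y => dx i f x y + dx i g x y) :=
  fun _ hx _ hy => pd_add i (hf.diffx hU hx hy) (hg.diffx hU hx hy)
lemma dy_add (hU : IsOpen U) (hf : Sm U f) (hg : Sm U g) (i : Fin n) :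
    EqD U (dy i (fun x y => f x y + g x y)) (fun x y => dy i f x y + dy i g x y) :=
  fun _ hx _ hy => pd_add i (hf.diffy hU hx hy) (hg.diffy hU hx hy)
lemma dx_mul (hU : IsOpen U) (hf : Sm U f) (hg : Sm U g) (i : Fin n) :
    EqD U (dx i (fun x y => f x y * g x y)) (fun x y => dx i f x y * g x y + f x y * dx i g x y) :=
  fun _ hx _ hy => pd_mul i (hf.diffx hU hx hy) (hg.diffx hU hx hy)
lemma dy_mul (hU : IsOpen U) (hf : Sm U f) (hg : Sm U g) (i : Fin n) :
    EqD U (dy i (fun x y => f x y * g x y)) (fun x y => dy i f x y * g x y + f x y * dy i g x y) :=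
  fun _ hx _ hy => pd_mul i (hf.diffy hU hx hy) (hg.diffy hU hx hy)
lemma dx_sum {ι : Type*} (s : Finset ι) (hU : IsOpen U) {f : ι → Vec n → Vec n → ℝ}
    (h : ∀ i ∈ s, Sm U (f i)) (i : Fin n) :
    EqD U (dx i (fun x y => ∑ j ∈ s, f j x y)) (fun x y => ∑ j ∈ s, dx i (f j) x y) :=
  fun _ hx _ hy => pd_sum s i (fun j hj => (h j hj).diffx hU hx hy)
lemma dy_sum {ι : Type*} (s : Finset ι) (hU : IsOpen U) {f : ι → Vec n → Vec n → ℝ}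
    (h : ∀ i ∈ s, Sm U (f i)) (i : Fin n) :
    EqD U (dy i (fun x y => ∑ j ∈ s, f j x y)) (fun x y => ∑ j ∈ s, dy i (f j) x y) :=
  fun _ hx _ hy => pd_sum s i (fun j hj => (h j hj).diffy hU hx hy)
lemma dx_coef (c : Vec n → ℝ) (i : Fin n) : dx i (fun x _ => c x) = fun x _ => pd i c x := rfl
lemma dy_coef (c : Vec n → ℝ) (i : Fin n) : dy i (fun x _ => c x) = fun _ _ => 0 := by
  funext x y; exact pd_const _ _ _
lemma dx_yc (j i : Fin n) : dx i (fun (_ y : Vec n) => y j) = fun _ _ => 0 := by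
  funext x y; exact pd_const _ _ _
lemma dy_yc (j i : Fin n) : dy i (fun (_ y : Vec n) => y j) = fun _ _ => if j = i then 1 else 0 := by
  funext x y; exact pd_coord _ _ _

lemma dx_mul' (hU : IsOpen U) (hf : Sm U f) (hg : Sm U g) (i : Fin n) {x y : Vec n} (hx : x ∈ U) (hy : y ≠ 0) :
    dx i (fun x y => f x y * g x y) x y = dx i f x y * g x y + f x y * dx i g x y :=
  dx_mul hU hf hg i x hx y hy
lemma dy_mul' (hU : IsOpen U) (hf : Sm U f) (hg : Sm U g) (i : Fin n) {x y : Vec n} (hx : x ∈ U) (hy : y ≠ 0) :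
    dy i (fun x y => f x y * g x y) x y = dy i f x y * g x y + f x y * dy i g x y :=
  dy_mul hU hf hg i x hx y hy
lemma dx_add' (hU : IsOpen U) (hf : Sm U f) (hg : Sm U g) (i : Fin n) {x y : Vec n} (hx : x ∈ U) (hy : y ≠ 0) :
    dx i (fun x y => f x y + g x y) x y = dx i f x y + dx i g x y :=
  dx_add hU hf hg i x hx y hy
lemma dy_add' (hU : IsOpen U) (hf : Sm U f) (hg : Sm U g) (i : Fin n) {x y : Vec n} (hx : x ∈ U) (hy : y ≠ 0) :
    dy i (fun x y => f x y + g x y) x y = dy i f x y + dy i g x y :=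
  dy_add hU hf hg i x hx y hy
lemma dx_sum' {ι : Type*} (s : Finset ι) (hU : IsOpen U) {f : ι → Vec n → Vec n → ℝ}
    (h : ∀ i ∈ s, Sm U (f i)) (i : Fin n) {x y : Vec n} (hx : x ∈ U) (hy : y ≠ 0) :
    dx i (fun x y => ∑ j ∈ s, f j x y) x y = ∑ j ∈ s, dx i (f j) x y :=
  dx_sum s hU h i x hx y hy
lemma dy_sum' {ι : Type*} (s : Finset ι) (hU : IsOpen U) {f : ι → Vec n → Vec n → ℝ}
    (h : ∀ i ∈ s, Sm U (f i)) (i : Fin n) {x y : Vec n} (hx : x ∈ U) (hy : y ≠ 0) :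
    dy i (fun x y => ∑ j ∈ s, f j x y) x y = ∑ j ∈ s, dy i (f j) x y :=
  dy_sum s hU h i x hx y hy

/-- Euler relation -/
lemma euler (hU : IsOpen U) (hf : Sm U f) (k : ℤ)
    (hk : ∀ x ∈ U, ∀ y, y ≠ 0 → ∀ t : ℝ, 0 < t → f x (t • y) = t ^ k * f x y)
    {x y : Vec n} (hx : x ∈ U) (hy : y ≠ 0) : ∑ i, dy i f x y * y i = k * f x y := by
  have hd := (hf.diffy hU hx hy).hasFDerivAt
  have h1 : HasDerivAt (fun t : ℝ => f x (t • y)) (fderiv ℝ (f x) y y) 1 := by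
    have hd' : HasFDerivAt (f x) (fderiv ℝ (f x) y) ((1 : ℝ) • y) := by simpa using hd
    have h2 : HasDerivAt (fun t : ℝ => t • y) y 1 := by
      simpa using (hasDerivAt_id (1 : ℝ)).smul_const y
    exact hd'.comp_hasDerivAt 1 h2
  have h3 : HasDerivAt (fun t : ℝ => f x (t • y)) (k * f x y) 1 := by
    have h4 : HasDerivAt (fun t : ℝ => t ^ k * f x y) ((k * (1 : ℝ) ^ (k - 1)) * f x y) 1 :=
      (hasDerivAt_zpow k 1 (Or.inl one_ne_zero)).mul_const _
    have h5 := h4.congr_of_eventuallyEq (f₁ := fun t : ℝ => f x (t • y)) (by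
      filter_upwards [lt_mem_nhds (zero_lt_one (α := ℝ))] with t ht using hk x hx y hy t ht)
    simpa using h5
  rw [← h1.unique h3]
  unfold dy pd
  conv_rhs => rw [show y = ∑ i, y i • (Pi.single i 1 : Vec n) by
    funext j; simp [Finset.sum_apply, Pi.single_apply]]
  rw [map_sum]
  simp_rw [map_smul]
  have hh : (∑ i, y i • (Pi.single i 1 : Vec n)) = y := by
    funext j; simp [Finset.sum_apply, Pi.single_apply]
  rw [hh]
  simp [mul_comm]

end calcs

section reg
variable {n : ℕ}

/-- working hypotheses -/
structure RD (a : Vec n → Matrix (Fin n) (Fin n) ℝ) (b : Vec n → Vec n) (U : Set (Vec n)) : Prop where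
  hU : IsOpen U
  ha : ∀ i j, ContDiffOn ℝ ∞ (fun x => a x i j) U
  hb : ∀ i, ContDiffOn ℝ ∞ (fun x => b x i) U
  symm : ∀ x ∈ U, ∀ i j, a x i j = a x j i
  pos : ∀ x ∈ U, ∀ y : Vec n, y ≠ 0 → 0 < ∑ i, ∑ j, a x i j * y i * y j
  posdef : ∀ x ∈ U, (a x).PosDef
  b2 : ∀ x ∈ U, bnormsq a b x < 1
  Fpos : ∀ x ∈ U, ∀ y : Vec n, y ≠ 0 → 0 < ralpha a x y + rbeta b x y

/-- The Randers function. -/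
def RF (a : Vec n → Matrix (Fin n) (Fin n) ℝ) (b : Vec n → Vec n) : Vec n → Vec n → ℝ :=
  fun x y => ralpha a x y + rbeta b x y

variable {a : Vec n → Matrix (Fin n) (Fin n) ℝ} {b : Vec n → Vec n} {U : Set (Vec n)}

lemma RD.apos (H : RD a b U) {x y : Vec n} (hx : x ∈ U) (hy : y ≠ 0) : 0 < ralpha a x y :=
  Real.sqrt_pos.mpr (H.pos x hx y hy)
lemma RD.asq (H : RD a b U) {x y : Vec n} (hx : x ∈ U) (hy : y ≠ 0) :
    ralpha a x y ^ 2 = ∑ i, ∑ j, a x i j * y i * y j :=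
  Real.sq_sqrt (H.pos x hx y hy).le

lemma RD.smA (H : RD a b U) : Sm U (fun x y => ∑ i, ∑ j, a x i j * y i * y j) :=
  Sm.sum _ fun i _ => Sm.sum _ fun j _ => ((Sm.coef (H.ha i j)).mul (Sm.yc i)).mul (Sm.yc j)
lemma RD.smAlpha (H : RD a b U) : Sm U (ralpha a) :=
  ContDiffOn.sqrt H.smA (fun p hp => (H.pos p.1 hp.1 p.2 hp.2).ne')
lemma RD.smBeta (H : RD a b U) : Sm U (rbeta b) :=
  Sm.sum _ fun i _ => (Sm.coef (H.hb i)).mul (Sm.yc i)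
lemma RD.smF (H : RD a b U) : Sm U (RF a b) := H.smAlpha.add H.smBeta
lemma Sm.inv {f : Vec n → Vec n → ℝ} (hf : Sm U f) (h : ∀ x ∈ U, ∀ y, y ≠ 0 → f x y ≠ 0) :
    Sm U (fun x y => (f x y)⁻¹) := ContDiffOn.inv hf (fun p hp => h p.1 hp.1 p.2 hp.2)

/-- lower index y -/
def yl (a : Vec n → Matrix (Fin n) (Fin n) ℝ) (i : Fin n) (x y : Vec n) : ℝ := ∑ j, a x i j * y j

lemma dx_A (H : RD a b U) (k : Fin n) :
    EqD U (dx k (fun x y => ∑ i, ∑ j, a x i j * y i * y j))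
      (fun x y => ∑ i, ∑ j, pd k (fun x => a x i j) x * y i * y j) := by
  intro x hx y hy
  have h1 : ∀ i j, Sm U (fun x y => a x i j * y i * y j) := fun i j =>
    ((Sm.coef (H.ha i j)).mul (Sm.yc i)).mul (Sm.yc j)
  rw [dx_sum _ H.hU (fun i _ => Sm.sum _ fun j _ => h1 i j) k x hx y hy]
  refine Finset.sum_congr rfl fun i _ => ?_
  rw [dx_sum _ H.hU (fun j _ => h1 i j) k x hx y hy]
  refine Finset.sum_congr rfl fun j _ => ?_
  rw [dx_mul' H.hU ((Sm.coef (H.ha i j)).mul (Sm.yc i)) (Sm.yc j) k hx hy,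
    dx_mul' H.hU (Sm.coef (H.ha i j)) (Sm.yc i) k hx hy, dx_yc, dx_yc, dx_coef]
  ring

lemma dy_A (H : RD a b U) (k : Fin n) :
    EqD U (dy k (fun x y => ∑ i, ∑ j, a x i j * y i * y j)) (fun x y => 2 * yl a k x y) := by
  intro x hx y hy
  have h1 : ∀ i j, Sm U (fun x y => a x i j * y i * y j) := fun i j =>
    ((Sm.coef (H.ha i j)).mul (Sm.yc i)).mul (Sm.yc j)
  rw [dy_sum _ H.hU (fun i _ => Sm.sum _ fun j _ => h1 i j) k x hx y hy]
  have : ∀ i, dy k (fun x y => ∑ j, a x i j * y i * y j) x y =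
      (if i = k then 1 else 0) * (∑ j, a x i j * y j) + a x k i * y i := by
    intro i
    rw [dy_sum _ H.hU (fun j _ => h1 i j) k x hx y hy]
    have : ∀ j, dy k (fun x y => a x i j * y i * y j) x y =
       (if i = k then 1 else 0) * (a x i j * y j) + a x i j * y i * (if j = k then 1 else 0) := by
      intro j
      rw [dy_mul' H.hU ((Sm.coef (H.ha i j)).mul (Sm.yc i)) (Sm.yc j) k hx hy,
        dy_mul' H.hU (Sm.coef (H.ha i j)) (Sm.yc i) k hx hy, dy_yc, dy_yc, dy_coef]
      ring
    simp_rw [this, Finset.sum_add_distrib, ← Finset.mul_sum]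
    congr 1
    simp [H.symm x hx i k]
  simp_rw [this, Finset.sum_add_distrib]
  simp [yl]; ring

/-- half the x-derivative of alpha squared -/
def Ax (a : Vec n → Matrix (Fin n) (Fin n) ℝ) (k : Fin n) (x y : Vec n) : ℝ :=
  ∑ i, ∑ j, pd k (fun x => a x i j) x * y i * y j

lemma dx_alpha (H : RD a b U) (k : Fin n) :
    EqD U (dx k (ralpha a)) (fun x y => (1/2) * Ax a k x y * (ralpha a x y)⁻¹) := by
  intro x hx y hy
  have h := pd_comp (g := Real.sqrt) k (H.smA.diffx H.hU hx hy)
    (Real.hasDerivAt_sqrt (H.pos x hx y hy).ne')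
  have h2 := dx_A H k x hx y hy
  unfold dx at h2
  rw [h2] at h
  refine Eq.trans h ?_
  simp only [Ax, ralpha, one_div, mul_inv]; ring

lemma dy_alpha (H : RD a b U) (k : Fin n) :
    EqD U (dy k (ralpha a)) (fun x y => yl a k x y * (ralpha a x y)⁻¹) := by
  intro x hx y hy
  have h := pd_comp (g := Real.sqrt) k (H.smA.diffy H.hU hx hy)
    (Real.hasDerivAt_sqrt (H.pos x hx y hy).ne')
  have h2 := dy_A H k x hx y hy
  unfold dy at h2
  rw [h2] at h
  refine Eq.trans h ?_
  simp only [ralpha, one_div, mul_inv]; ring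

lemma dx_inv {f : Vec n → Vec n → ℝ} (hU : IsOpen U) (hf : Sm U f)
    (h : ∀ x ∈ U, ∀ y, y ≠ 0 → f x y ≠ 0) (k : Fin n) :
    EqD U (dx k (fun x y => (f x y)⁻¹)) (fun x y => -(dx k f x y) * ((f x y)⁻¹ * (f x y)⁻¹)) := by
  intro x hx y hy
  have h := pd_comp (g := fun z => z⁻¹) k (hf.diffx hU hx hy) (hasDerivAt_inv (h x hx y hy))
  refine Eq.trans h ?_
  simp only [dx, pow_two, mul_inv]; ring
lemma dy_inv {f : Vec n → Vec n → ℝ} (hU : IsOpen U) (hf : Sm U f)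
    (h : ∀ x ∈ U, ∀ y, y ≠ 0 → f x y ≠ 0) (k : Fin n) :
    EqD U (dy k (fun x y => (f x y)⁻¹)) (fun x y => -(dy k f x y) * ((f x y)⁻¹ * (f x y)⁻¹)) := by
  intro x hx y hy
  have h := pd_comp (g := fun z => z⁻¹) k (hf.diffy hU hx hy) (hasDerivAt_inv (h x hx y hy))
  refine Eq.trans h ?_
  simp only [dy, pow_two, mul_inv]; ring

lemma dx_beta (H : RD a b U) (k : Fin n) :
    EqD U (dx k (rbeta b)) (fun x y => ∑ i, pd k (fun x => b x i) x * y i) := by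
  intro x hx y hy
  have h1 : ∀ i ∈ Finset.univ, Sm U (fun x y => b x i * y i) := fun i _ => (Sm.coef (H.hb i)).mul (Sm.yc i)
  refine Eq.trans (dx_sum _ H.hU h1 k x hx y hy) ?_
  refine Finset.sum_congr rfl fun i _ => ?_
  rw [dx_mul H.hU (Sm.coef (H.hb i)) (Sm.yc i) k x hx y hy, dx_yc, dx_coef]
  ring
lemma dy_beta (H : RD a b U) (k : Fin n) :
    EqD U (dy k (rbeta b)) (fun x y => b x k) := by
  intro x hx y hy
  have h1 : ∀ i ∈ Finset.univ, Sm U (fun x y => b x i * y i) := fun i _ => (Sm.coef (H.hb i)).mul (Sm.yc i)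
  refine Eq.trans (dy_sum _ H.hU h1 k x hx y hy) ?_
  have : ∀ i, dy k (fun x y => b x i * y i) x y = b x i * if i = k then 1 else 0 := by
    intro i
    rw [dy_mul H.hU (Sm.coef (H.hb i)) (Sm.yc i) k x hx y hy, dy_yc, dy_coef]
    ring
  simp [this]

/-- Homogeneous (degree `k`) functions, regular up to a pole of order `m` in `F`. -/
inductive Reg (a : Vec n → Matrix (Fin n) (Fin n) ℝ) (b : Vec n → Vec n) (U : Set (Vec n)) :
    ℤ → ℕ → (Vec n → Vec n → ℝ) → Prop
  | coef (c : Vec n → ℝ) (hc : ContDiffOn ℝ ∞ c U) : Reg a b U 0 0 (fun x _ => c x)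
  | yc (i : Fin n) : Reg a b U 1 0 (fun _ y => y i)
  | al : Reg a b U 1 0 (ralpha a)
  | ali : Reg a b U (-1) 0 (fun x y => (ralpha a x y)⁻¹)
  | Fi : Reg a b U (-1) 1 (fun x y => (RF a b x y)⁻¹)
  | zero (k : ℤ) : Reg a b U k 0 (fun _ _ => 0)
  | add {k m f g} (hf : Reg a b U k m f) (hg : Reg a b U k m g) :
      Reg a b U k m (fun x y => f x y + g x y)
  | mul {k m f k' m' g} (hf : Reg a b U k m f) (hg : Reg a b U k' m' g) :
      Reg a b U (k + k') (m + m') (fun x y => f x y * g x y)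
  | mono {k m f m'} (hf : Reg a b U k m f) (h : m ≤ m') : Reg a b U k m' f
  | congr {k m f g} (hf : Reg a b U k m f) (h : EqD U f g) : Reg a b U k m g

lemma Reg.cast {k k' m m' f} (h : Reg a b U k m f) (hk : k = k') (hm : m ≤ m') :
    Reg a b U k' m' f := hk ▸ h.mono hm
lemma Reg.mul' {k m f k' m' g} {k'' m''} (hf : Reg a b U k m f) (hg : Reg a b U k' m' g)
    (hk : k + k' = k'' := by norm_num) (hm : m + m' ≤ m'' := by norm_num) :
    Reg a b U k'' m'' (fun x y => f x y * g x y) := (hf.mul hg).cast hk hm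
lemma Reg.const (c : ℝ) : Reg a b U 0 0 (fun _ _ => c) := Reg.coef (fun _ => c) contDiffOn_const
lemma Reg.sum {ι : Type*} (s : Finset ι) {k m} {f : ι → Vec n → Vec n → ℝ}
    (h : ∀ i ∈ s, Reg a b U k m (f i)) : Reg a b U k m (fun x y => ∑ i ∈ s, f i x y) := by
  classical
  induction s using Finset.induction_on with
  | empty => simpa using (Reg.zero k).mono (Nat.zero_le m)
  | insert i s hi ih =>
    simp_rw [Finset.sum_insert hi]
    exact (h i (Finset.mem_insert_self _ _)).add (ih fun j hj => h j (Finset.mem_insert_of_mem hj))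
lemma Reg.cmul {k m f} (c : ℝ) (h : Reg a b U k m f) : Reg a b U k m (fun x y => c * f x y) :=
  (Reg.const c).mul' h (by simp) (by simp)
lemma Reg.neg {k m f} (h : Reg a b U k m f) : Reg a b U k m (fun x y => - f x y) := by
  simpa using h.cmul (-1)
lemma Reg.sub {k m f g} (h : Reg a b U k m f) (h' : Reg a b U k m g) :
    Reg a b U k m (fun x y => f x y - g x y) := by
  simpa [sub_eq_add_neg] using h.add h'.neg
lemma Reg.beta (H : RD a b U) : Reg a b U 1 0 (rbeta b) :=
  Reg.sum _ fun i _ => (Reg.coef _ (H.hb i)).mul' (Reg.yc i)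
lemma Reg.F (H : RD a b U) : Reg a b U 1 0 (RF a b) := Reg.al.add (Reg.beta H)
lemma Reg.yl (H : RD a b U) (i : Fin n) : Reg a b U 1 0 (yl a i) :=
  Reg.sum _ fun j _ => (Reg.coef _ (H.ha i j)).mul' (Reg.yc j)
lemma Reg.Ax (H : RD a b U) (k : Fin n) : Reg a b U 2 0 (Ax a k) :=
  Reg.sum _ fun i _ => Reg.sum _ fun j _ =>
    ((Reg.coef _ (pd_smooth H.hU (H.ha i j) k)).mul' (Reg.yc i) (k'' := 1) (m'' := 0)).mul' (Reg.yc j)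

/-- pole order after differentiation -/
def dm (m : ℕ) : ℕ := if m = 0 then 0 else m + 1
lemma dm_ge (m : ℕ) : m ≤ dm m := by unfold dm; split_ifs <;> omega
lemma dm_mono {m m' : ℕ} (h : m ≤ m') : dm m ≤ dm m' := by unfold dm; split_ifs <;> omega
lemma dm_l (m m' : ℕ) : dm m + m' ≤ dm (m + m') := by unfold dm; split_ifs <;> omega
lemma dm_r (m m' : ℕ) : m + dm m' ≤ dm (m + m') := by unfold dm; split_ifs <;> omega

lemma RD.Fne (H : RD a b U) : ∀ x ∈ U, ∀ y, y ≠ 0 → RF a b x y ≠ 0 :=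
  fun x hx y hy => (H.Fpos x hx y hy).ne'
lemma RD.ane (H : RD a b U) : ∀ x ∈ U, ∀ y, y ≠ 0 → ralpha a x y ≠ 0 :=
  fun x hx y hy => (H.apos hx hy).ne'

lemma ralpha_hom (x y : Vec n) {t : ℝ} (ht : 0 < t) : ralpha a x (t • y) = t * ralpha a x y := by
  unfold ralpha
  rw [← Real.sqrt_sq ht.le, ← Real.sqrt_mul (sq_nonneg t), Real.sqrt_sq ht.le]
  congr 1
  rw [Finset.mul_sum]; refine Finset.sum_congr rfl fun i _ => ?_
  rw [Finset.mul_sum]; refine Finset.sum_congr rfl fun j _ => ?_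
  simp; ring
lemma rbeta_hom (x y : Vec n) {t : ℝ} : rbeta b x (t • y) = t * rbeta b x y := by
  unfold rbeta
  rw [Finset.mul_sum]; refine Finset.sum_congr rfl fun i _ => ?_
  simp; ring

/-- homogeneity on the domain -/
def Hom (U : Set (Vec n)) (k : ℤ) (f : Vec n → Vec n → ℝ) : Prop :=
  ∀ x ∈ U, ∀ y, y ≠ 0 → ∀ t : ℝ, 0 < t → f x (t • y) = t ^ k * f x y

lemma Reg.props (H : RD a b U) {k m f} (h : Reg a b U k m f) :
    Sm U f ∧ Hom U k f ∧ (∀ i, Reg a b U k (dm m) (dx i f)) ∧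
      (∀ i, Reg a b U (k - 1) (dm m) (dy i f)) := by
  have tne : ∀ {t : ℝ} {y : Vec n}, 0 < t → y ≠ 0 → t • y ≠ 0 := fun ht hy =>
    smul_ne_zero ht.ne' hy
  induction h with
  | coef c hc =>
    refine ⟨Sm.coef hc, fun x hx y hy t ht => by simp, fun i => ?_, fun i => ?_⟩
    · exact Reg.coef _ (pd_smooth H.hU hc i)
    · rw [dy_coef]; exact Reg.zero _
  | yc j =>
    refine ⟨Sm.yc j, fun x hx y hy t ht => by simp, fun i => ?_, fun i => ?_⟩
    · rw [dx_yc]; exact Reg.zero _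
    · rw [dy_yc]; exact Reg.const _
  | al =>
    refine ⟨H.smAlpha, fun x hx y hy t ht => by simp [ralpha_hom x y ht], fun i => ?_, fun i => ?_⟩
    · exact (((Reg.Ax H i).cmul _).mul' Reg.ali (k'' := 1) (m'' := 0)).congr (dx_alpha H i).symm
    · exact ((Reg.yl H i).mul' Reg.ali (k'' := 0) (m'' := 0)).congr (dy_alpha H i).symm
  | ali =>
    refine ⟨H.smAlpha.inv H.ane, fun x hx y hy t ht => by simp [ralpha_hom x y ht, mul_comm],
      fun i => ?_, fun i => ?_⟩
    · refine Reg.congr ?_ (dx_inv H.hU H.smAlpha H.ane i).symm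
      have h1 := (((Reg.Ax H i).cmul (1/2)).mul' Reg.ali (k'' := 1) (m'' := 0)).congr (dx_alpha H i).symm
      exact h1.neg.mul' (Reg.ali.mul' Reg.ali (k'' := -2) (m'' := 0))
    · refine Reg.congr ?_ (dy_inv H.hU H.smAlpha H.ane i).symm
      have h1 := ((Reg.yl H i).mul' Reg.ali (k'' := 0) (m'' := 0)).congr (dy_alpha H i).symm
      exact h1.neg.mul' (Reg.ali.mul' Reg.ali (k'' := -2) (m'' := 0))
  | Fi =>
    refine ⟨H.smF.inv H.Fne, fun x hx y hy t ht => ?_, fun i => ?_, fun i => ?_⟩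
    · simp only [RF, ralpha_hom x y ht, rbeta_hom x y, ← mul_add, mul_inv]; simp
    · refine Reg.congr ?_ (dx_inv H.hU H.smF H.Fne i).symm
      have h1 := (((Reg.Ax H i).cmul (1/2)).mul' Reg.ali (k'' := 1) (m'' := 0)).congr (dx_alpha H i).symm
      have h2 := (Reg.sum (a := a) (b := b) Finset.univ fun j _ => (Reg.coef _ (pd_smooth H.hU (H.hb j) i)).mul'
        (Reg.yc j) (k'' := 1) (m'' := 0)).congr (dx_beta H i).symm
      have h3 := (h1.add h2).congr (dx_add H.hU H.smAlpha H.smBeta i).symm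
      exact h3.neg.mul' (Reg.Fi.mul' Reg.Fi (k'' := -2) (m'' := 2)) (by norm_num) (by simp [dm])
    · refine Reg.congr ?_ (dy_inv H.hU H.smF H.Fne i).symm
      have h1 := ((Reg.yl H i).mul' Reg.ali (k'' := 0) (m'' := 0)).congr (dy_alpha H i).symm
      have h2 := (Reg.coef (a := a) (b := b) _ (H.hb i)).congr (dy_beta H i).symm
      have h3 := (h1.add h2).congr (dy_add H.hU H.smAlpha H.smBeta i).symm
      exact h3.neg.mul' (Reg.Fi.mul' Reg.Fi (k'' := -2) (m'' := 2)) (by norm_num) (by simp [dm])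
  | zero k =>
    refine ⟨Sm.coef (c := fun _ => 0) contDiffOn_const, fun x hx y hy t ht => by simp, fun i => ?_, fun i => ?_⟩
    · have := dx_coef (n := n) (fun _ => 0) i
      rw [this]; simpa [pd_const, dm] using Reg.zero k
    · rw [dy_coef (fun _ => 0)]; exact Reg.zero _
  | add hf hg ihf ihg =>
    obtain ⟨f1, f2, f3, f4⟩ := ihf
    obtain ⟨g1, g2, g3, g4⟩ := ihg
    refine ⟨f1.add g1, fun x hx y hy t ht => ?_, fun i => ?_, fun i => ?_⟩
    · simp only [f2 x hx y hy t ht, g2 x hx y hy t ht, mul_add]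
    · exact ((f3 i).add (g3 i)).congr (dx_add H.hU f1 g1 i).symm
    · exact ((f4 i).add (g4 i)).congr (dy_add H.hU f1 g1 i).symm
  | mul hf hg ihf ihg =>
    obtain ⟨f1, f2, f3, f4⟩ := ihf
    obtain ⟨g1, g2, g3, g4⟩ := ihg
    refine ⟨f1.mul g1, fun x hx y hy t ht => ?_, fun i => ?_, fun i => ?_⟩
    · simp only [f2 x hx y hy t ht, g2 x hx y hy t ht, zpow_add₀ ht.ne']; ring
    · exact (((f3 i).mul' hg rfl (dm_l _ _)).add (hf.mul' (g3 i) rfl (dm_r _ _))).congr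
        (dx_mul H.hU f1 g1 i).symm
    · exact (((f4 i).mul' hg (by ring) (dm_l _ _)).add (hf.mul' (g4 i) (by ring) (dm_r _ _))).congr
        (dy_mul H.hU f1 g1 i).symm
  | mono hf h ih =>
    obtain ⟨f1, f2, f3, f4⟩ := ih
    exact ⟨f1, f2, fun i => (f3 i).mono (dm_mono h), fun i => (f4 i).mono (dm_mono h)⟩
  | congr hf h ih =>
    obtain ⟨f1, f2, f3, f4⟩ := ih
    refine ⟨f1.congr h, fun x hx y hy t ht => ?_, fun i => (f3 i).congr (h.dx H.hU i),
      fun i => (f4 i).congr (h.dy i)⟩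
    rw [← h x hx y hy, ← h x hx _ (tne ht hy)]; exact f2 x hx y hy t ht

lemma Reg.sm (H : RD a b U) {k m f} (h : Reg a b U k m f) : Sm U f := (h.props H).1
lemma Reg.dx (H : RD a b U) {k m f} (h : Reg a b U k m f) (i : Fin n) :
  Reg a b U k (dm m) (dx i f) := (h.props H).2.2.1 i
lemma Reg.dy (H : RD a b U) {k m f} (h : Reg a b U k m f) (i : Fin n) :
  Reg a b U (k - 1) (dm m) (dy i f) := (h.props H).2.2.2 i
lemma Reg.euler (H : RD a b U) {k m f} (h : Reg a b U k m f) {x y : Vec n} (hx : x ∈ U) (hy : y ≠ 0) :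
    ∑ i, _root_.dy i f x y * y i = k * f x y :=
  _root_.euler H.hU (h.sm H) k (h.props H).2.1 hx hy

/-- clearing the pole -/
lemma Reg.clear (H : RD a b U) {k m f} (h : Reg a b U k m f) :
    ∃ g, Reg a b U (k + m) 0 g ∧ EqD U (fun x y => f x y * RF a b x y ^ m) g := by
  induction h with
  | coef c hc => exact ⟨_, by simpa using Reg.coef c hc, fun x hx y hy => by simp⟩
  | yc j => exact ⟨_, by simpa using Reg.yc j, fun x hx y hy => by simp⟩
  | al => exact ⟨_, by simpa using Reg.al, fun x hx y hy => by simp⟩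
  | ali => exact ⟨_, by simpa using Reg.ali, fun x hx y hy => by simp⟩
  | Fi => exact ⟨_, by simpa using Reg.const 1, fun x hx y hy => by simp [H.Fne x hx y hy]⟩
  | zero k => exact ⟨_, Reg.zero _, fun x hx y hy => by simp⟩
  | add hf hg ihf ihg =>
    obtain ⟨f', f1, f2⟩ := ihf
    obtain ⟨g', g1, g2⟩ := ihg
    refine ⟨_, f1.add g1, fun x hx y hy => ?_⟩
    simp only [← f2 x hx y hy, ← g2 x hx y hy]; ring
  | mul hf hg ihf ihg =>
    obtain ⟨f', f1, f2⟩ := ihf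
    obtain ⟨g', g1, g2⟩ := ihg
    refine ⟨_, f1.mul' g1 (by push_cast; ring) (by norm_num), fun x hx y hy => ?_⟩
    simp only [← f2 x hx y hy, ← g2 x hx y hy]; ring
  | @mono k m f m' hf h ih =>
    obtain ⟨f', f1, f2⟩ := ih
    have : ∀ j : ℕ, Reg a b U (j : ℤ) 0 (fun x y => RF a b x y ^ j) := by
      intro j
      induction j with
      | zero => simpa using Reg.const 1
      | succ j ih => simp_rw [pow_succ]; exact ih.mul' (Reg.F H) (by push_cast; ring) (by norm_num)
    refine ⟨_, f1.mul' (this (m' - m)) (by push_cast [h]; ring) (by norm_num), fun x hx y hy => ?_⟩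
    simp only [← f2 x hx y hy]
    rw [mul_assoc, ← pow_add, Nat.add_sub_cancel' h]
  | congr hf h ih =>
    obtain ⟨f', f1, f2⟩ := ih
    exact ⟨f', f1, fun x hx y hy => by simp only [← h x hx y hy]; exact f2 x hx y hy⟩

end reg

section geo
variable {n : ℕ} {a : Vec n → Matrix (Fin n) (Fin n) ℝ} {b : Vec n → Vec n} {U : Set (Vec n)}

lemma det_smooth {M : Vec n → Matrix (Fin n) (Fin n) ℝ}
    (h : ∀ i j, ContDiffOn ℝ ∞ (fun x => M x i j) U) : ContDiffOn ℝ ∞ (fun x => (M x).det) U := by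
  simp_rw [Matrix.det_apply']
  exact ContDiffOn.sum fun σ _ => contDiffOn_const.mul (contDiffOn_prod fun i _ => h _ _)

lemma RD.det_pos (H : RD a b U) {x : Vec n} (hx : x ∈ U) : 0 < (a x).det := (H.posdef x hx).det_pos

lemma RD.ainv_smooth (H : RD a b U) (i j : Fin n) : ContDiffOn ℝ ∞ (fun x => (a x)⁻¹ i j) U := by
  have : ∀ x, (a x)⁻¹ i j = ((a x).det)⁻¹ * ((a x).updateRow j (Pi.single i 1)).det := by
    intro x
    rw [Matrix.inv_def, Matrix.smul_apply, Matrix.adjugate_apply, Ring.inverse_eq_inv', smul_eq_mul]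
  simp_rw [this]
  refine ((det_smooth H.ha).inv fun x hx => (H.det_pos hx).ne').mul (det_smooth fun k l => ?_)
  by_cases hk : k = j
  · subst hk; simpa using contDiffOn_const
  · simpa [Matrix.updateRow_ne hk] using H.ha k l

lemma RD.mul_inv (H : RD a b U) {x : Vec n} (hx : x ∈ U) : a x * (a x)⁻¹ = 1 :=
  Matrix.mul_nonsing_inv _ (H.det_pos hx).ne'.isUnit
lemma RD.inv_mul (H : RD a b U) {x : Vec n} (hx : x ∈ U) : (a x)⁻¹ * a x = 1 :=
  Matrix.nonsing_inv_mul _ (H.det_pos hx).ne'.isUnit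
lemma RD.inv_symm (H : RD a b U) {x : Vec n} (hx : x ∈ U) (i j : Fin n) :
    (a x)⁻¹ i j = (a x)⁻¹ j i := by
  have h : (a x)ᵀ = a x := by ext i j; exact H.symm x hx j i
  have : ((a x)⁻¹)ᵀ = (a x)⁻¹ := by rw [Matrix.transpose_nonsing_inv, h]
  exact (congrFun (congrFun this j) i)

/-- raise an index -/
def up (a : Vec n → Matrix (Fin n) (Fin n) ℝ) (x : Vec n) (w : Vec n) (i : Fin n) : ℝ :=
  ∑ l, (a x)⁻¹ i l * w l

lemma RD.a_up (H : RD a b U) {x : Vec n} (hx : x ∈ U) (w : Vec n) (i : Fin n) :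
    ∑ j, a x i j * up a x w j = w i := by
  have : a x *ᵥ ((a x)⁻¹ *ᵥ w) = w := by rw [Matrix.mulVec_mulVec, H.mul_inv hx, Matrix.one_mulVec]
  exact congrFun this i
lemma RD.up_adj (H : RD a b U) {x : Vec n} (hx : x ∈ U) (v w : Vec n) :
    ∑ i, v i * up a x w i = ∑ i, up a x v i * w i := by
  simp_rw [up, Finset.mul_sum, Finset.sum_mul]
  rw [Finset.sum_comm]
  refine Finset.sum_congr rfl fun i _ => Finset.sum_congr rfl fun j _ => ?_
  rw [H.inv_symm hx]; ring
lemma RD.up_yl (H : RD a b U) {x : Vec n} (hx : x ∈ U) (y : Vec n) (i : Fin n) :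
    up a x (fun l => yl a l x y) i = y i := by
  have : (a x)⁻¹ *ᵥ (a x *ᵥ y) = y := by rw [Matrix.mulVec_mulVec, H.inv_mul hx, Matrix.one_mulVec]
  exact congrFun this i
lemma RD.yl_up (H : RD a b U) {x : Vec n} (hx : x ∈ U) (y w : Vec n) :
    ∑ i, yl a i x y * up a x w i = ∑ i, y i * w i := by
  rw [H.up_adj hx (fun i => yl a i x y)]
  simp_rw [H.up_yl hx]
lemma bnormsq_eq (x : Vec n) : bnormsq a b x = ∑ i, b x i * up a x (b x) i := by
  simp_rw [bnormsq, up, Finset.mul_sum]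
  exact Finset.sum_congr rfl fun i _ => Finset.sum_congr rfl fun j _ => by ring
lemma RD.yl_y (H : RD a b U) {x y : Vec n} (hx : x ∈ U) (hy : y ≠ 0) :
    ∑ i, yl a i x y * y i = ralpha a x y ^ 2 := by
  rw [H.asq hx hy]
  simp_rw [yl, Finset.sum_mul]
  exact Finset.sum_congr rfl fun i _ => Finset.sum_congr rfl fun j _ => by ring

/-- y-derivative of F -/
def Fy (a : Vec n → Matrix (Fin n) (Fin n) ℝ) (b : Vec n → Vec n) (l : Fin n) (x y : Vec n) : ℝ :=
  yl a l x y * (ralpha a x y)⁻¹ + b x l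
def Bx (b : Vec n → Vec n) (m : Fin n) (x y : Vec n) : ℝ := ∑ i, pd m (fun x => b x i) x * y i
def Fx (a : Vec n → Matrix (Fin n) (Fin n) ℝ) (b : Vec n → Vec n) (l : Fin n) (x y : Vec n) : ℝ :=
  (1/2) * Ax a l x y * (ralpha a x y)⁻¹ + Bx b l x y

lemma dy_F (H : RD a b U) (l : Fin n) : EqD U (dy l (RF a b)) (Fy a b l) := fun x hx y hy => by
  refine (dy_add' H.hU H.smAlpha H.smBeta l hx hy).trans ?_
  rw [dy_alpha H l x hx y hy, dy_beta H l x hx y hy]; rfl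
lemma dx_F (H : RD a b U) (l : Fin n) : EqD U (dx l (RF a b)) (Fx a b l) := fun x hx y hy => by
  refine (dx_add' H.hU H.smAlpha H.smBeta l hx hy).trans ?_
  rw [dx_alpha H l x hx y hy, dx_beta H l x hx y hy]; rfl

lemma Reg.Fy (H : RD a b U) (l : Fin n) : Reg a b U 0 0 (Fy a b l) :=
  ((Reg.yl H l).mul' Reg.ali).add (Reg.coef _ (H.hb l))
lemma Reg.Bx (H : RD a b U) (l : Fin n) : Reg a b U 1 0 (Bx b l) :=
  Reg.sum _ fun i _ => (Reg.coef _ (pd_smooth H.hU (H.hb i) l)).mul' (Reg.yc i)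
lemma Reg.Fx (H : RD a b U) (l : Fin n) : Reg a b U 1 0 (Fx a b l) :=
  (((Reg.Ax H l).cmul _).mul' Reg.ali).add (Reg.Bx H l)

lemma dy_yl (H : RD a b U) (l k : Fin n) : EqD U (dy k (yl a l)) (fun x _ => a x l k) := by
  intro x hx y hy
  refine (dy_sum' _ H.hU (fun j _ => (Sm.coef (H.ha l j)).mul (Sm.yc j)) k hx hy).trans ?_
  have : ∀ j, dy k (fun x y => a x l j * y j) x y = a x l j * if j = k then 1 else 0 := by
    intro j
    rw [dy_mul' H.hU (Sm.coef (H.ha l j)) (Sm.yc j) k hx hy, dy_yc, dy_coef]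
    ring
  simp [this]
lemma dx_yl (H : RD a b U) (l k : Fin n) :
    EqD U (dx k (yl a l)) (fun x y => ∑ j, pd k (fun x => a x l j) x * y j) := by
  intro x hx y hy
  refine (dx_sum' _ H.hU (fun j _ => (Sm.coef (H.ha l j)).mul (Sm.yc j)) k hx hy).trans ?_
  refine Finset.sum_congr rfl fun j _ => ?_
  rw [dx_mul' H.hU (Sm.coef (H.ha l j)) (Sm.yc j) k hx hy, dx_yc, dx_coef]
  ring

lemma dy_Fy (H : RD a b U) (l k : Fin n) : EqD U (dy k (Fy a b l)) (fun x y =>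
    a x l k * (ralpha a x y)⁻¹ - yl a l x y * yl a k x y * (ralpha a x y)⁻¹ ^ 3) := by
  intro x hx y hy
  have s1 := (Reg.yl H l).sm H
  have s2 := (Reg.ali (a := a) (b := b) (U := U)).sm H
  have s3 := Sm.coef (H.hb l)
  refine (dy_add' H.hU (s1.mul s2) s3 k hx hy).trans ?_
  rw [dy_mul' H.hU s1 s2 k hx hy, dy_yl H l k x hx y hy, dy_coef (fun x => b x l),
    dy_inv H.hU H.smAlpha H.ane k x hx y hy]
  beta_reduce
  rw [dy_alpha H k x hx y hy]
  ring
lemma dx_Fy (H : RD a b U) (l k : Fin n) : EqD U (dx k (Fy a b l)) (fun x y =>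
    (∑ j, pd k (fun x => a x l j) x * y j) * (ralpha a x y)⁻¹
      - (1/2) * yl a l x y * Ax a k x y * (ralpha a x y)⁻¹ ^ 3 + pd k (fun x => b x l) x) := by
  intro x hx y hy
  have s1 := (Reg.yl H l).sm H
  have s2 := (Reg.ali (a := a) (b := b) (U := U)).sm H
  have s3 := Sm.coef (H.hb l)
  refine (dx_add' H.hU (s1.mul s2) s3 k hx hy).trans ?_
  rw [dx_mul' H.hU s1 s2 k hx hy, dx_yl H l k x hx y hy, dx_coef (fun x => b x l),
    dx_inv H.hU H.smAlpha H.ane k x hx y hy]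
  beta_reduce
  rw [dx_alpha H k x hx y hy]
  ring

lemma dy_F2 (H : RD a b U) (l : Fin n) :
    EqD U (dy l (F2 (RF a b))) (fun x y => 2 * (RF a b x y * Fy a b l x y)) := by
  intro x hx y hy
  have : F2 (RF a b) = fun x y => RF a b x y * RF a b x y := by funext x y; simp [F2, sq]
  rw [this, dy_mul' H.hU H.smF H.smF l hx hy, dy_F H l x hx y hy]; ring
lemma dx_F2 (H : RD a b U) (l : Fin n) :
    EqD U (dx l (F2 (RF a b))) (fun x y => 2 * (RF a b x y * Fx a b l x y)) := by
  intro x hx y hy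
  have : F2 (RF a b) = fun x y => RF a b x y * RF a b x y := by funext x y; simp [F2, sq]
  rw [this, dx_mul' H.hU H.smF H.smF l hx hy, dx_F H l x hx y hy]; ring

lemma gmat_eq (H : RD a b U) {x y : Vec n} (hx : x ∈ U) (hy : y ≠ 0) (i j : Fin n) :
    gmat (RF a b) x y i j = Fy a b i x y * Fy a b j x y + RF a b x y *
      (a x i j * (ralpha a x y)⁻¹ - yl a i x y * yl a j x y * (ralpha a x y)⁻¹ ^ 3) := by
  have sF := (Reg.Fy H j).sm H
  have s1 : Sm U (fun _ _ => (2 : ℝ)) := Sm.coef contDiffOn_const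
  simp only [gmat, Matrix.of_apply]
  rw [(dy_F2 H j).dy i x hx y hy, dy_mul' H.hU s1 (H.smF.mul sF) i hx hy,
    dy_mul' H.hU H.smF sF i hx hy, dy_coef (fun _ => (2:ℝ)), dy_F H i x hx y hy,
    dy_Fy H j i x hx y hy]
  beta_reduce
  rw [H.symm x hx j i]
  ring

lemma g_mulVec (H : RD a b U) {x y : Vec n} (hx : x ∈ U) (hy : y ≠ 0) (X : Vec n) (i : Fin n) :
    ∑ j, gmat (RF a b) x y i j * X j =
      Fy a b i x y * ((∑ j, yl a j x y * X j) * (ralpha a x y)⁻¹ + ∑ j, b x j * X j)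
      + RF a b x y * ((∑ j, a x i j * X j) * (ralpha a x y)⁻¹
        - yl a i x y * (∑ j, yl a j x y * X j) * (ralpha a x y)⁻¹ ^ 3) := by
  simp_rw [gmat_eq H hx hy, Finset.mul_sum, Finset.sum_mul]
  rw [← Finset.sum_add_distrib, ← Finset.sum_sub_distrib, Finset.mul_sum, Finset.mul_sum, ← Finset.sum_add_distrib]
  refine Finset.sum_congr rfl fun j _ => ?_
  simp only [Fy]; ring

lemma ginv_eq (H : RD a b U) {x y : Vec n} (hx : x ∈ U) (hy : y ≠ 0) :
    gmat (RF a b) x y * ginv (RF a b) x y = 1 ∧ ginv (RF a b) x y * gmat (RF a b) x y = 1 ∧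
    ∀ j k, ginv (RF a b) x y j k = ralpha a x y * (RF a b x y)⁻¹ * (a x)⁻¹ j k
      - ralpha a x y * (RF a b x y)⁻¹ ^ 2 * (up a x (b x) j * y k + up a x (b x) k * y j)
      + (bnormsq a b x * ralpha a x y + rbeta b x y) * (RF a b x y)⁻¹ ^ 3 * (y j * y k) := by
  set M : Matrix (Fin n) (Fin n) ℝ := Matrix.of fun j k =>
    ralpha a x y * (RF a b x y)⁻¹ * (a x)⁻¹ j k
      - ralpha a x y * (RF a b x y)⁻¹ ^ 2 * (up a x (b x) j * y k + up a x (b x) k * y j)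
      + (bnormsq a b x * ralpha a x y + rbeta b x y) * (RF a b x y)⁻¹ ^ 3 * (y j * y k) with hM
  have key : gmat (RF a b) x y * M = 1 := by
    ext i k
    rw [Matrix.mul_apply]
    have e1 := g_mulVec H hx hy (up a x (Pi.single k 1)) i
    have e2 := g_mulVec H hx hy (up a x (b x)) i
    have e3 := g_mulVec H hx hy y i
    rw [H.yl_up hx, H.a_up hx] at e1 e2
    rw [H.up_adj hx (b x)] at e1
    rw [← bnormsq_eq] at e2
    rw [H.yl_y hx hy] at e3
    have f1 : ∀ j, up a x (Pi.single k 1) j = (a x)⁻¹ j k := fun j => by simp [up, Pi.single_apply]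
    have f2 : ∑ i, y i * (Pi.single k 1 : Vec n) i = y k := by simp [Pi.single_apply]
    have f3 : ∑ i, up a x (b x) i * (Pi.single k 1 : Vec n) i = up a x (b x) k := by
      simp [Pi.single_apply]
    have f4 : ∑ i, y i * b x i = rbeta b x y := by simp [rbeta, mul_comm]
    have f5 : ∑ i, b x i * y i = rbeta b x y := rfl
    have f6 : ∑ j, a x i j * y j = yl a i x y := rfl
    simp_rw [f1] at e1
    rw [f2, f3] at e1
    rw [f4] at e2
    rw [f5, f6] at e3
    have : ∑ j, gmat (RF a b) x y i j * M j k =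
        ralpha a x y * (RF a b x y)⁻¹ * (∑ j, gmat (RF a b) x y i j * (a x)⁻¹ j k)
        - ralpha a x y * (RF a b x y)⁻¹ ^ 2 * ((∑ j, gmat (RF a b) x y i j * up a x (b x) j) * y k
          + up a x (b x) k * ∑ j, gmat (RF a b) x y i j * y j)
        + (bnormsq a b x * ralpha a x y + rbeta b x y) * (RF a b x y)⁻¹ ^ 3 *
          ((∑ j, gmat (RF a b) x y i j * y j) * y k) := by
      simp_rw [Finset.mul_sum, Finset.sum_mul]
      rw [← Finset.sum_add_distrib, Finset.mul_sum, Finset.mul_sum, ← Finset.sum_sub_distrib,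
        ← Finset.sum_add_distrib]
      refine Finset.sum_congr rfl fun j _ => ?_
      simp only [hM, Matrix.of_apply]; ring
    rw [this, e1, e2, e3]
    have hF := H.Fne x hx y hy
    have hA := H.ane x hx y hy
    have hFd : rbeta b x y = RF a b x y - ralpha a x y := by simp [RF]
    have f7 : (1 : Matrix (Fin n) (Fin n) ℝ) i k = (Pi.single k 1 : Vec n) i := by
      simp [Matrix.one_apply, Pi.single_apply]
    rw [f7, hFd]
    simp only [Fy]
    field_simp
    ring
  have h2 : ginv (RF a b) x y = M := Matrix.inv_eq_right_inv key
  refine ⟨h2 ▸ key, ?_, fun j k => by rw [h2]; rfl⟩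
  rw [h2]; exact mul_eq_one_comm.mp key

/-- lowered spray of α -/
def Gl (a : Vec n → Matrix (Fin n) (Fin n) ℝ) (l : Fin n) (x y : Vec n) : ℝ :=
  (1/2) * ((∑ m, (∑ j, pd m (fun x => a x l j) x * y j) * y m) - (1/2) * Ax a l x y)
def sl (b : Vec n → Vec n) (l : Fin n) (x y : Vec n) : ℝ :=
  (1/2) * ((∑ m, pd m (fun x => b x l) x * y m) - Bx b l x y)
def s0 (a : Vec n → Matrix (Fin n) (Fin n) ℝ) (b : Vec n → Vec n) (x y : Vec n) : ℝ :=
  ∑ l, up a x (b x) l * sl b l x y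
def e00 (a : Vec n → Matrix (Fin n) (Fin n) ℝ) (b : Vec n → Vec n) (x y : Vec n) : ℝ :=
  (∑ m, Bx b m x y * y m) - 2 * (∑ l, up a x (b x) l * Gl a l x y) + 2 * (rbeta b x y * s0 a b x y)
def Gh (a : Vec n → Matrix (Fin n) (Fin n) ℝ) (b : Vec n → Vec n) (i : Fin n) (x y : Vec n) : ℝ :=
  (∑ l, (a x)⁻¹ i l * (Gl a l x y + ralpha a x y * sl b l x y)) - s0 a b x y * y i
def Pp (a : Vec n → Matrix (Fin n) (Fin n) ℝ) (b : Vec n → Vec n) (x y : Vec n) : ℝ :=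
  (1/2) * (e00 a b x y * (RF a b x y)⁻¹)

lemma Reg.B (H : RD a b U) (l : Fin n) : Reg a b U 0 0 (fun x _ => up a x (b x) l) :=
  Reg.coef _ (ContDiffOn.sum fun i _ => (H.ainv_smooth l i).mul (H.hb i))
lemma Reg.Gl (H : RD a b U) (l : Fin n) : Reg a b U 2 0 (Gl a l) :=
  Reg.cmul _ ((Reg.sum _ fun m _ => Reg.mul' (k := 1) (m := 0) (Reg.sum _ fun j _ =>
    (Reg.coef _ (pd_smooth H.hU (H.ha l j) m)).mul' (Reg.yc j)) (Reg.yc m)).sub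
    ((Reg.Ax H l).cmul _))
lemma Reg.sl (H : RD a b U) (l : Fin n) : Reg a b U 1 0 (sl b l) :=
  Reg.cmul _ ((Reg.sum _ fun m _ =>
    (Reg.coef _ (pd_smooth H.hU (H.hb l) m)).mul' (Reg.yc m)).sub (Reg.Bx H l))
lemma Reg.s0 (H : RD a b U) : Reg a b U 1 0 (s0 a b) :=
  Reg.sum _ fun l _ => (Reg.B H l).mul' (Reg.sl H l)
lemma Reg.e00 (H : RD a b U) : Reg a b U 2 0 (e00 a b) :=
  ((Reg.sum _ fun m _ => (Reg.Bx H m).mul' (Reg.yc m)).sub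
    ((Reg.sum _ fun l _ => (Reg.B H l).mul' (Reg.Gl H l)).cmul _)).add
    (((Reg.beta H).mul' (Reg.s0 H)).cmul _)
lemma Reg.Gh (H : RD a b U) (i : Fin n) : Reg a b U 2 0 (Gh a b i) :=
  (Reg.sum _ fun l _ => (Reg.coef _ (H.ainv_smooth i l)).mul'
    ((Reg.Gl H l).add (Reg.al.mul' (Reg.sl H l)))).sub ((Reg.s0 H).mul' (Reg.yc i))
lemma Reg.Pp (H : RD a b U) : Reg a b U 1 1 (Pp a b) :=
  Reg.cmul _ ((Reg.e00 H).mul' Reg.Fi)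

lemma y_Gl (x y : Vec n) : ∑ l, y l * Gl a l x y = (1/4) * ∑ m, Ax a m x y * y m := by
  have h1 : ∑ l, y l * (∑ m, (∑ j, pd m (fun x => a x l j) x * y j) * y m)
      = ∑ m, Ax a m x y * y m := by
    simp_rw [Finset.mul_sum, Ax, Finset.sum_mul, Finset.mul_sum]
    rw [Finset.sum_comm]
    refine Finset.sum_congr rfl fun m _ => Finset.sum_congr rfl fun i _ => 
      Finset.sum_congr rfl fun j _ => by ring
  have h2 : ∑ l, y l * Gl a l x y = (1/2) * (∑ l, y l * (∑ m, (∑ j, pd m (fun x => a x l j) x * y j) * y m))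
     - (1/4) * ∑ m, Ax a m x y * y m := by
    rw [Finset.mul_sum, Finset.mul_sum, ← Finset.sum_sub_distrib]
    refine Finset.sum_congr rfl fun l _ => ?_
    simp only [Gl]; ring
  rw [h2, h1]; ring

lemma y_sl (x y : Vec n) : ∑ l, y l * sl b l x y = 0 := by
  have h1 : ∑ l, y l * (∑ m, pd m (fun x => b x l) x * y m) = ∑ m, y m * Bx b m x y := by
    simp_rw [Bx, Finset.mul_sum]
    rw [Finset.sum_comm]
    refine Finset.sum_congr rfl fun m _ => Finset.sum_congr rfl fun i _ => by ring
  have h2 : ∑ l, y l * sl b l x y = (1/2) * ((∑ l, y l * (∑ m, pd m (fun x => b x l) x * y m))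
     - ∑ m, y m * Bx b m x y) := by
    rw [← Finset.sum_sub_distrib, Finset.mul_sum]
    refine Finset.sum_congr rfl fun l _ => ?_
    simp only [sl]; ring
  rw [h2, h1]; ring

lemma geo_rhs (H : RD a b U) {x y : Vec n} (hx : x ∈ U) (hy : y ≠ 0) (l : Fin n) :
    (∑ m, dx m (fun x' y' => dy l (F2 (RF a b)) x' y') x y * y m) - dx l (F2 (RF a b)) x y =
    2 * ((1/2) * (∑ m, Ax a m x y * y m) * (ralpha a x y)⁻¹ + ∑ m, Bx b m x y * y m) * Fy a b l x y
    + 2 * RF a b x y * (2 * Gl a l x y * (ralpha a x y)⁻¹ + 2 * sl b l x y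
      - (1/2) * yl a l x y * (∑ m, Ax a m x y * y m) * (ralpha a x y)⁻¹ ^ 3) := by
  have sF := (Reg.Fy H l).sm H
  have s1 : Sm U (fun _ _ => (2 : ℝ)) := Sm.coef contDiffOn_const
  have h1 : ∀ m, dx m (fun x' y' => dy l (F2 (RF a b)) x' y') x y =
      2 * (Fx a b m x y * Fy a b l x y + RF a b x y * ((∑ j, pd m (fun x => a x l j) x * y j) * (ralpha a x y)⁻¹
      - (1/2) * yl a l x y * Ax a m x y * (ralpha a x y)⁻¹ ^ 3 + pd m (fun x => b x l) x)) := by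
    intro m
    rw [(dy_F2 H l).dx H.hU m x hx y hy, dx_mul' H.hU s1 (H.smF.mul sF) m hx hy,
      dx_mul' H.hU H.smF sF m hx hy, dx_coef (fun _ => (2:ℝ)), dx_F H m x hx y hy,
      dx_Fy H l m x hx y hy]
    beta_reduce
    rw [pd_const]
    ring
  simp_rw [h1]
  rw [dx_F2 H l x hx y hy]
  have h2 : ∑ m, 2 * (Fx a b m x y * Fy a b l x y + RF a b x y * ((∑ j, pd m (fun x => a x l j) x * y j) * (ralpha a x y)⁻¹
      - (1/2) * yl a l x y * Ax a m x y * (ralpha a x y)⁻¹ ^ 3 + pd m (fun x => b x l) x)) * y m =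
      2 * ((1/2) * (∑ m, Ax a m x y * y m) * (ralpha a x y)⁻¹ + ∑ m, Bx b m x y * y m) * Fy a b l x y
      + 2 * RF a b x y * ((∑ m, (∑ j, pd m (fun x => a x l j) x * y j) * y m) * (ralpha a x y)⁻¹
        - (1/2) * yl a l x y * (ralpha a x y)⁻¹ ^ 3 * (∑ m, Ax a m x y * y m)
        + ∑ m, pd m (fun x => b x l) x * y m) := by
    simp only [Finset.mul_sum (s := Finset.univ) (f := fun m => Ax a m x y * y m)]
    rw [Finset.sum_mul, Finset.sum_mul, ← Finset.sum_sub_distrib, ← Finset.sum_add_distrib,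
      ← Finset.sum_add_distrib, Finset.mul_sum, Finset.mul_sum, Finset.sum_mul, ← Finset.sum_add_distrib]
    refine Finset.sum_congr rfl fun m _ => ?_
    simp only [Fx]; ring
  rw [h2]
  simp only [Gl, sl, Fx]
  ring

lemma g_V (H : RD a b U) {x y : Vec n} (hx : x ∈ U) (hy : y ≠ 0) (l : Fin n) :
    (∑ m, dx m (fun x' y' => dy l (F2 (RF a b)) x' y') x y * y m) - dx l (F2 (RF a b)) x y =
    4 * ∑ j, gmat (RF a b) x y l j * (Gh a b j x y + Pp a b x y * y j) := by
  rw [geo_rhs H hx hy]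
  have e1 := g_mulVec H hx hy (up a x (fun l => Gl a l x y + ralpha a x y * sl b l x y)) l
  have e3 := g_mulVec H hx hy y l
  rw [H.yl_up hx, H.a_up hx, H.up_adj hx (b x)] at e1
  rw [H.yl_y hx hy] at e3
  have f5 : ∑ i, b x i * y i = rbeta b x y := rfl
  have f6 : ∑ j, a x l j * y j = yl a l x y := rfl
  rw [f5, f6] at e3
  have f1 : ∑ i, y i * (Gl a i x y + ralpha a x y * sl b i x y) = (1/4) * ∑ m, Ax a m x y * y m := by
    simp_rw [mul_add, Finset.sum_add_distrib, y_Gl, mul_left_comm (y _) (ralpha a x y),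
      ← Finset.mul_sum, y_sl]
    ring
  have f2 : ∑ i, up a x (b x) i * (Gl a i x y + ralpha a x y * sl b i x y) =
      (∑ i, up a x (b x) i * Gl a i x y) + ralpha a x y * s0 a b x y := by
    simp_rw [mul_add, Finset.sum_add_distrib, mul_left_comm _ (ralpha a x y),
      ← Finset.mul_sum]
    rfl
  rw [f1, f2] at e1
  have : ∑ j, gmat (RF a b) x y l j * (Gh a b j x y + Pp a b x y * y j) =
      (∑ j, gmat (RF a b) x y l j * up a x (fun l => Gl a l x y + ralpha a x y * sl b l x y) j)
      + (Pp a b x y - s0 a b x y) * ∑ j, gmat (RF a b) x y l j * y j := by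
    rw [Finset.mul_sum, ← Finset.sum_add_distrib]
    refine Finset.sum_congr rfl fun j _ => ?_
    simp only [Gh, up]; ring
  rw [this, e1, e3]
  have hF := H.Fne x hx y hy
  have hA := H.ane x hx y hy
  have hFd : rbeta b x y = RF a b x y - ralpha a x y := by simp [RF]
  simp only [Pp, e00]
  rw [hFd]
  generalize Fy a b l x y = X
  field_simp
  ring

lemma Geo_eq (H : RD a b U) (i : Fin n) :
    EqD U (Geo (RF a b) i) (fun x y => Gh a b i x y + Pp a b x y * y i) := by
  intro x hx y hy
  simp only [Geo]
  simp_rw [g_V H hx hy]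
  have h := (ginv_eq H hx hy).2.1
  have h2 : ginv (RF a b) x y *ᵥ (gmat (RF a b) x y *ᵥ fun j => Gh a b j x y + Pp a b x y * y j)
     = fun j => Gh a b j x y + Pp a b x y * y j := by
    rw [Matrix.mulVec_mulVec, h, Matrix.one_mulVec]
  have h3 := congrFun h2 i
  simp only [Matrix.mulVec, dotProduct] at h3
  rw [← h3, Finset.mul_sum]
  refine Finset.sum_congr rfl fun j _ => ?_
  ring

/-- first order relation -/
lemma F_V (H : RD a b U) {x y : Vec n} (hx : x ∈ U) (hy : y ≠ 0) :
    2 * ∑ j, Fy a b j x y * Gh a b j x y = (∑ m, Fx a b m x y * y m) - e00 a b x y := by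
  have t : ∀ j, Fy a b j x y * Gh a b j x y =
     (ralpha a x y)⁻¹ * (yl a j x y * up a x (fun l => Gl a l x y + ralpha a x y * sl b l x y) j)
     + b x j * up a x (fun l => Gl a l x y + ralpha a x y * sl b l x y) j
     - s0 a b x y * ((ralpha a x y)⁻¹ * (yl a j x y * y j) + b x j * y j) := by
    intro j; simp only [Fy, Gh, up]; ring
  have f5 : ∑ i, b x i * y i = rbeta b x y := rfl
  have f1 : ∑ i, y i * (Gl a i x y + ralpha a x y * sl b i x y) = (1/4) * ∑ m, Ax a m x y * y m := by
    simp_rw [mul_add, Finset.sum_add_distrib, y_Gl, mul_left_comm (y _) (ralpha a x y),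
      ← Finset.mul_sum, y_sl]
    ring
  have f2 : ∑ i, up a x (b x) i * (Gl a i x y + ralpha a x y * sl b i x y) =
      (∑ i, up a x (b x) i * Gl a i x y) + ralpha a x y * s0 a b x y := by
    simp_rw [mul_add, Finset.sum_add_distrib, mul_left_comm _ (ralpha a x y),
      ← Finset.mul_sum]
    rfl
  have f3 : ∑ m, Fx a b m x y * y m = (1/2) * (∑ m, Ax a m x y * y m) * (ralpha a x y)⁻¹
      + ∑ m, Bx b m x y * y m := by
    rw [Finset.mul_sum, Finset.sum_mul, ← Finset.sum_add_distrib]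
    refine Finset.sum_congr rfl fun j _ => ?_
    simp only [Fx]; ring
  simp_rw [t, Finset.sum_sub_distrib, Finset.sum_add_distrib, ← Finset.mul_sum,
    Finset.sum_add_distrib, ← Finset.mul_sum]
  rw [H.yl_up hx, H.up_adj hx (b x), H.yl_y hx hy, f5, f1, f2, f3]
  have hA := H.ane x hx y hy
  simp only [e00]
  field_simp
  ring

end geo

section ric
variable {n : ℕ} {a : Vec n → Matrix (Fin n) (Fin n) ℝ} {b : Vec n → Vec n} {U : Set (Vec n)}

lemma dx_P (H : RD a b U) (k : Fin n) {x y : Vec n} (hx : x ∈ U) (hy : y ≠ 0) :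
    dx k (Pp a b) x y = -(1/2) * e00 a b x y * Fx a b k x y * (RF a b x y)⁻¹ ^ 2
      + (1/2) * (dx k (e00 a b) x y * (RF a b x y)⁻¹) := by
  have s1 : Sm U (fun _ _ => (1/2 : ℝ)) := Sm.coef contDiffOn_const
  have s2 := (Reg.e00 H).sm H
  have s3 := (Reg.Fi (a := a) (b := b) (U := U)).sm H
  refine (dx_mul' H.hU s1 (s2.mul s3) k hx hy).trans ?_
  rw [dx_mul' H.hU s2 s3 k hx hy, dx_inv H.hU H.smF H.Fne k x hx y hy, dx_coef (fun _ => (1/2 : ℝ))]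
  beta_reduce
  rw [pd_const, dx_F H k x hx y hy]
  ring
lemma dy_P (H : RD a b U) (k : Fin n) {x y : Vec n} (hx : x ∈ U) (hy : y ≠ 0) :
    dy k (Pp a b) x y = -(1/2) * e00 a b x y * Fy a b k x y * (RF a b x y)⁻¹ ^ 2
      + (1/2) * (dy k (e00 a b) x y * (RF a b x y)⁻¹) := by
  have s1 : Sm U (fun _ _ => (1/2 : ℝ)) := Sm.coef contDiffOn_const
  have s2 := (Reg.e00 H).sm H
  have s3 := (Reg.Fi (a := a) (b := b) (U := U)).sm H
  refine (dy_mul' H.hU s1 (s2.mul s3) k hx hy).trans ?_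
  rw [dy_mul' H.hU s2 s3 k hx hy, dy_inv H.hU H.smF H.Fne k x hx y hy, dy_coef (fun _ => (1/2 : ℝ))]
  beta_reduce
  rw [dy_F H k x hx y hy]
  ring

/-- divergence of the regular part -/
def Dh (a : Vec n → Matrix (Fin n) (Fin n) ℝ) (b : Vec n → Vec n) (x y : Vec n) : ℝ :=
  ∑ m, dy m (Gh a b m) x y

lemma Reg.Dh (H : RD a b U) : Reg a b U 1 0 (Dh a b) :=
  Reg.sum _ fun m _ => ((Reg.Gh H m).dy H m).cast (by norm_num) (by simp [dm])

lemma dxG (H : RD a b U) (i k : Fin n) : EqD U (dx k (Geo (RF a b) i))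
    (fun x y => dx k (Gh a b i) x y + dx k (Pp a b) x y * y i) := by
  intro x hx y hy
  have s1 := (Reg.Gh H i).sm H
  have s2 := (Reg.Pp H).sm H
  rw [(Geo_eq H i).dx H.hU k x hx y hy, dx_add' H.hU s1 (s2.mul (Sm.yc i)) k hx hy,
    dx_mul' H.hU s2 (Sm.yc i) k hx hy, dx_yc]
  ring
lemma dyG (H : RD a b U) (i k : Fin n) : EqD U (dy k (Geo (RF a b) i))
    (fun x y => dy k (Gh a b i) x y + dy k (Pp a b) x y * y i + Pp a b x y * if i = k then 1 else 0) := by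
  intro x hx y hy
  have s1 := (Reg.Gh H i).sm H
  have s2 := (Reg.Pp H).sm H
  rw [(Geo_eq H i).dy k x hx y hy, dy_add' H.hU s1 (s2.mul (Sm.yc i)) k hx hy,
    dy_mul' H.hU s2 (Sm.yc i) k hx hy, dy_yc]
  ring

lemma Reg.Geo (H : RD a b U) (i : Fin n) : Reg a b U 2 1 (Geo (RF a b) i) :=
  (((Reg.Gh H i).mono (Nat.zero_le 1)).add ((Reg.Pp H).mul' (Reg.yc i))).congr (Geo_eq H i).symm

lemma divG (H : RD a b U) : EqD U (fun x y => ∑ m, dy m (Geo (RF a b) m) x y)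
    (fun x y => Dh a b x y + ((n : ℝ) + 1) * Pp a b x y) := by
  intro x hx y hy
  have h := (Reg.Pp H).euler H hx hy
  have : ∀ m, dy m (Geo (RF a b) m) x y =
      dy m (Gh a b m) x y + dy m (Pp a b) x y * y m + Pp a b x y := by
    intro m; rw [dyG H m m x hx y hy]; simp
  simp_rw [this, Finset.sum_add_distrib]
  rw [h]
  simp [Dh]; ring

lemma T2 (H : RD a b U) {x y : Vec n} (hx : x ∈ U) (hy : y ≠ 0) :
    ∑ m, ∑ j, dy m (fun x' y' => dx j (Geo (RF a b) m) x' y') x y * y j =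
    (∑ m, ∑ j, dy m (dx j (Gh a b m)) x y * y j) + ((n : ℝ) + 1) * ∑ j, dx j (Pp a b) x y * y j := by
  have h1 : ∀ m j, dy m (fun x' y' => dx j (Geo (RF a b) m) x' y') x y =
      dy m (dx j (Gh a b m)) x y + (dy m (dx j (Pp a b)) x y * y m + dx j (Pp a b) x y) := by
    intro m j
    have s1 := ((Reg.Gh H m).dx H j).sm H
    have s2 := ((Reg.Pp H).dx H j).sm H
    rw [(dxG H m j).dy m x hx y hy, dy_add' H.hU s1 (s2.mul (Sm.yc m)) m hx hy,
      dy_mul' H.hU s2 (Sm.yc m) m hx hy, dy_yc]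
    simp
  have h2 : ∀ j, ∑ m, dy m (dx j (Pp a b)) x y * y m = dx j (Pp a b) x y := by
    intro j; rw [((Reg.Pp H).dx H j).euler H hx hy]; simp
  simp_rw [h1, add_mul, Finset.sum_add_distrib]
  congr 1
  rw [Finset.sum_comm]
  simp_rw [← Finset.sum_mul, h2]
  simp; ring

lemma T3 (H : RD a b U) {x y : Vec n} (hx : x ∈ U) (hy : y ≠ 0) :
    ∑ m, 2 * ∑ j, Geo (RF a b) j x y * dy j (fun x' y' => dy m (Geo (RF a b) m) x' y') x y =
    2 * (∑ j, Gh a b j x y * dy j (Dh a b) x y) + 2 * (Pp a b x y * Dh a b x y)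
     + 2 * ((n : ℝ) + 1) * (∑ j, Gh a b j x y * dy j (Pp a b) x y)
     + 2 * ((n : ℝ) + 1) * (Pp a b x y * Pp a b x y) := by
  have h1 : ∀ j, ∑ m, dy j (fun x' y' => dy m (Geo (RF a b) m) x' y') x y =
      dy j (Dh a b) x y + ((n : ℝ) + 1) * dy j (Pp a b) x y := by
    intro j
    have s1 : ∀ m ∈ Finset.univ, Sm U (fun x' y' => dy m (Geo (RF a b) m) x' y') :=
      fun m _ => ((Reg.Geo H m).dy H m).sm H
    have s2 : Sm U (fun _ _ => ((n : ℝ) + 1)) := Sm.coef contDiffOn_const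
    have s3 := (Reg.Pp H).sm H
    rw [← dy_sum' _ H.hU s1 j hx hy, (divG H).dy j x hx y hy,
      dy_add' H.hU ((Reg.Dh H).sm H) (s2.mul s3) j hx hy, dy_mul' H.hU s2 s3 j hx hy,
      dy_coef (fun _ => (n : ℝ) + 1)]
    simp
  have h2 := (Reg.Dh H).euler H hx hy
  have h3 := (Reg.Pp H).euler H hx hy
  simp only [Int.cast_one, one_mul] at h2 h3
  rw [← Finset.mul_sum, Finset.sum_comm]
  simp_rw [← Finset.mul_sum, h1]
  have h4 : ∀ j, Geo (RF a b) j x y * (dy j (Dh a b) x y + ((n : ℝ) + 1) * dy j (Pp a b) x y) =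
     Gh a b j x y * dy j (Dh a b) x y + Pp a b x y * (dy j (Dh a b) x y * y j)
     + ((n : ℝ) + 1) * (Gh a b j x y * dy j (Pp a b) x y)
     + ((n : ℝ) + 1) * (Pp a b x y * (dy j (Pp a b) x y * y j)) := by
    intro j; rw [Geo_eq H j x hx y hy]; ring
  simp_rw [h4, Finset.sum_add_distrib, ← Finset.mul_sum, h2, h3]
  ring

lemma T4 (H : RD a b U) {x y : Vec n} (hx : x ∈ U) (hy : y ≠ 0) :
    ∑ m, ∑ j, dy j (Geo (RF a b) m) x y * dy m (Geo (RF a b) j) x y =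
    (∑ m, ∑ j, dy j (Gh a b m) x y * dy m (Gh a b j) x y)
     + 4 * (∑ j, Gh a b j x y * dy j (Pp a b) x y) + 2 * (Pp a b x y * Dh a b x y)
     + ((n : ℝ) + 3) * (Pp a b x y * Pp a b x y) := by
  have h3 := (Reg.Pp H).euler H hx hy
  simp only [Int.cast_one, one_mul] at h3
  have h2 : ∀ i, ∑ j, dy j (Gh a b i) x y * y j = 2 * Gh a b i x y := fun i => by
    simpa using (Reg.Gh H i).euler H hx hy
  have h4 : ∀ m j, dy j (Geo (RF a b) m) x y * dy m (Geo (RF a b) j) x y =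
     dy j (Gh a b m) x y * dy m (Gh a b j) x y
     + dy m (Pp a b) x y * (dy j (Gh a b m) x y * y j) + dy j (Pp a b) x y * (dy m (Gh a b j) x y * y m)
     + (dy m (Pp a b) x y * y m) * (dy j (Pp a b) x y * y j)
     + (if m = j then (2 * (Pp a b x y * dy m (Gh a b m) x y)
        + 2 * (Pp a b x y * (dy m (Pp a b) x y * y m)) + Pp a b x y * Pp a b x y) else 0) := by
    intro m j; rw [dyG H m j x hx y hy, dyG H j m x hx y hy]
    by_cases h : m = j
    · subst h; simp; ring
    · have h' : ¬ j = m := fun e => h e.symm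
      simp [h, h']; ring
  simp_rw [h4, Finset.sum_add_distrib]
  rw [Finset.sum_comm (f := fun m j => dy j (Pp a b) x y * (dy m (Gh a b j) x y * y m))]
  simp_rw [← Finset.mul_sum, ← Finset.sum_mul, h2, h3]
  simp only [Finset.sum_ite_eq, Finset.mem_univ, if_true, Finset.sum_add_distrib, ← Finset.mul_sum,
    h3, Finset.sum_const, Finset.card_univ, Fintype.card_fin, nsmul_eq_mul]
  simp only [Dh]
  have h5 : ∑ i, dy i (Pp a b) x y * (2 * Gh a b i x y) = 2 * ∑ j, Gh a b j x y * dy j (Pp a b) x y := by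
    rw [Finset.mul_sum]; exact Finset.sum_congr rfl fun i _ => by ring
  rw [h5]
  ring

lemma Ric_eq (H : RD a b U) : ∃ h, Reg a b U 2 1 h ∧ EqD U (RicciC (RF a b)) (fun x y =>
    (3/4 * ((n : ℝ) - 1) * (e00 a b x y * e00 a b x y)) * (RF a b x y)⁻¹ ^ 2 + h x y) := by
  refine ⟨fun x y => (2 * (∑ m, dx m (Gh a b m) x y)
     - (∑ m, ∑ j, dy m (dx j (Gh a b m)) x y * y j)
     + 2 * (∑ j, Gh a b j x y * dy j (Dh a b) x y)
     - (∑ m, ∑ j, dy j (Gh a b m) x y * dy m (Gh a b j) x y))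
     + ((n : ℝ) - 1) * ((∑ j, Gh a b j x y * (dy j (e00 a b) x y * (RF a b x y)⁻¹))
        - (1/2) * ∑ j, (dx j (e00 a b) x y * (RF a b x y)⁻¹) * y j), ?_, ?_⟩
  · refine Reg.add (Reg.mono (m := 0) ?_ (Nat.zero_le 1)) ?_
    · refine Reg.sub (Reg.add (Reg.sub (Reg.cmul _ ?_) ?_) (Reg.cmul _ ?_)) ?_
      · exact Reg.sum _ fun m _ => ((Reg.Gh H m).dx H m).cast rfl (by simp [dm])
      · exact Reg.sum _ fun m _ => Reg.sum _ fun j _ =>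
          (((Reg.Gh H m).dx H j).dy H m).mul' (Reg.yc j) (by norm_num) (by simp [dm])
      · exact Reg.sum _ fun j _ => (Reg.Gh H j).mul' ((Reg.Dh H).dy H j) (by norm_num) (by simp [dm])
      · exact Reg.sum _ fun m _ => Reg.sum _ fun j _ =>
          ((Reg.Gh H m).dy H j).mul' ((Reg.Gh H j).dy H m) (by norm_num) (by simp [dm])
    · refine Reg.cmul _ (Reg.sub ?_ (Reg.cmul _ ?_))
      · exact Reg.sum _ fun j _ => (Reg.Gh H j).mul'
          (((Reg.e00 H).dy H j).mul' Reg.Fi (k'' := 0) (m'' := 1) (by norm_num) (by simp [dm]))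
      · exact Reg.sum _ fun j _ =>
          (((Reg.e00 H).dx H j).mul' Reg.Fi (k'' := 1) (m'' := 1) (by norm_num) (by simp [dm])).mul' (Reg.yc j)
  · intro x hx y hy
    have t1 : ∑ m, 2 * dx m (Geo (RF a b) m) x y =
        2 * (∑ m, dx m (Gh a b m) x y) + 2 * ∑ j, dx j (Pp a b) x y * y j := by
      have : ∀ m, dx m (Geo (RF a b) m) x y = dx m (Gh a b m) x y + dx m (Pp a b) x y * y m :=
        fun m => dxG H m m x hx y hy
      simp_rw [this, ← Finset.mul_sum, Finset.sum_add_distrib]; ring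
    have e0 : RicciC (RF a b) x y = (∑ m, 2 * dx m (Geo (RF a b) m) x y)
      - (∑ m, ∑ j, dy m (fun x' y' => dx j (Geo (RF a b) m) x' y') x y * y j)
      + (∑ m, 2 * ∑ j, Geo (RF a b) j x y * dy j (fun x' y' => dy m (Geo (RF a b) m) x' y') x y)
      - ∑ m, ∑ j, dy j (Geo (RF a b) m) x y * dy m (Geo (RF a b) j) x y := by
      simp only [RicciC, Riem, Finset.sum_sub_distrib, Finset.sum_add_distrib]
    rw [e0, t1, T2 H hx hy, T3 H hx hy, T4 H hx hy]
    have p1 : ∑ j, dx j (Pp a b) x y * y j =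
        -(1/2) * e00 a b x y * (RF a b x y)⁻¹ ^ 2 * (∑ j, Fx a b j x y * y j)
        + (1/2) * ∑ j, (dx j (e00 a b) x y * (RF a b x y)⁻¹) * y j := by
      simp_rw [dx_P H _ hx hy, Finset.mul_sum]
      rw [← Finset.sum_add_distrib]
      exact Finset.sum_congr rfl fun i _ => by ring
    have p2 : ∑ j, Gh a b j x y * dy j (Pp a b) x y =
        -(1/2) * e00 a b x y * (RF a b x y)⁻¹ ^ 2 * (∑ j, Fy a b j x y * Gh a b j x y)
        + (1/2) * ∑ j, Gh a b j x y * (dy j (e00 a b) x y * (RF a b x y)⁻¹) := by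
      simp_rw [dy_P H _ hx hy, Finset.mul_sum]
      rw [← Finset.sum_add_distrib]
      exact Finset.sum_congr rfl fun i _ => by ring
    have p3 := F_V H hx hy
    have p4 : ∑ m, Fx a b m x y * y m = 2 * (∑ j, Fy a b j x y * Gh a b j x y) + e00 a b x y := by
      rw [p3]; ring
    rw [p1, p2, p4]
    simp only [Pp]
    ring

lemma dy_Fi_pow (H : RD a b U) (i : Fin n) (m : ℕ) {x y : Vec n} (hx : x ∈ U) (hy : y ≠ 0) :
    dy i (fun x y => (RF a b x y)⁻¹ ^ m) x y = -(m : ℝ) * Fy a b i x y * (RF a b x y)⁻¹ ^ (m + 1) := by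
  have hd : HasDerivAt (fun z : ℝ => z⁻¹ ^ m) ((m : ℝ) * (RF a b x y)⁻¹ ^ (m - 1) * (-((RF a b x y) ^ 2)⁻¹))
      (RF a b x y) := (hasDerivAt_inv (H.Fne x hx y hy)).pow m
  have h := pd_comp (g := fun z : ℝ => z⁻¹ ^ m) i (H.smF.diffy H.hU hx hy) hd
  have h2 := dy_F H i x hx y hy
  unfold dy at h2
  rw [h2] at h
  refine Eq.trans h ?_
  rcases m with _ | m
  · simp
  · simp only [Nat.add_sub_cancel, pow_succ, mul_inv]; push_cast; ring

lemma Reg.Fip (m : ℕ) : Reg a b U (-(m : ℤ)) m (fun x y => (RF a b x y)⁻¹ ^ m) := by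
  induction m with
  | zero => simpa using Reg.const 1
  | succ m ih =>
    simp_rw [pow_succ]
    exact ih.mul' Reg.Fi (by push_cast; ring) (by norm_num)

lemma poleD (H : RD a b U) (i : Fin n) {k : ℤ} (m : ℕ) {X h f : Vec n → Vec n → ℝ}
    (hX : Reg a b U k 0 X) (hh : Reg a b U (k - (m + 1 : ℕ)) m h) (hm : m ≠ 0)
    (hf : EqD U f (fun x y => X x y * (RF a b x y)⁻¹ ^ (m + 1) + h x y)) :
    ∃ h', Reg a b U (k - (m + 2 : ℕ)) (m + 1) h' ∧
      EqD U (dy i f) (fun x y => (-((m + 1 : ℕ) : ℝ) * X x y * Fy a b i x y) *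
        (RF a b x y)⁻¹ ^ (m + 2) + h' x y) := by
  refine ⟨fun x y => dy i X x y * (RF a b x y)⁻¹ ^ (m + 1) + dy i h x y, ?_, ?_⟩
  · refine ((hX.dy H i).mul' (Reg.Fip (m + 1)) (by push_cast; ring) (by simp [dm])).add
      ((hh.dy H i).cast (by push_cast; ring) (by simp [dm, hm]))
  · intro x hx y hy
    have s1 := hX.sm H
    have s2 := (Reg.Fip (a := a) (b := b) (U := U) (m + 1)).sm H
    rw [hf.dy i x hx y hy, dy_add' H.hU (s1.mul s2) (hh.sm H) i hx hy, dy_mul' H.hU s1 s2 i hx hy,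
      dy_Fi_pow H i (m + 1) hx hy]
    ring

lemma RD.b2_smooth (H : RD a b U) : ContDiffOn ℝ ∞ (bnormsq a b) U :=
  ContDiffOn.sum fun i _ => ContDiffOn.sum fun j _ =>
    ((H.ainv_smooth i j).mul (H.hb i)).mul (H.hb j)

lemma rearr (c1 c2 c3 : ℝ) (A H : Fin n → Fin n → ℝ) (B y : Fin n → ℝ) :
    ∑ i, ∑ j, (c1 * A i j - c2 * (B i * y j + B j * y i) + c3 * (y i * y j)) * (1 / 2 * H i j) =
    (1/2) * (c1 * ∑ i, ∑ j, A i j * H i j) - (1/2) * c2 * ((∑ i, B i * ∑ j, H i j * y j)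
      + ∑ j, B j * ∑ i, H i j * y i) + (1/2) * c3 * ∑ j, (∑ i, H i j * y i) * y j := by
  have s1 : ∑ j, B j * ∑ i, H i j * y i = ∑ i, ∑ j, B j * H i j * y i := by
    simp_rw [Finset.mul_sum]
    rw [Finset.sum_comm]
    simp_rw [mul_assoc]
  have s2 : ∑ j, (∑ i, H i j * y i) * y j = ∑ i, ∑ j, H i j * y i * y j := by
    simp_rw [Finset.sum_mul]
    rw [Finset.sum_comm]
  rw [s1, s2]
  simp_rw [← Finset.sum_add_distrib, Finset.mul_sum, ← Finset.sum_add_distrib, Finset.mul_sum,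
    ← Finset.sum_sub_distrib, ← Finset.sum_add_distrib]
  refine Finset.sum_congr rfl fun i _ => Finset.sum_congr rfl fun j _ => ?_
  ring

lemma scal_eq (H : RD a b U) : ∃ h, Reg a b U 0 4 h ∧ EqD U (scalarCurv (RF a b)) (fun x y =>
    (-(9/2) * ((n : ℝ) - 1) * (1 - bnormsq a b x) * ralpha a x y * (e00 a b x y * e00 a b x y))
      * (RF a b x y)⁻¹ ^ 5 + h x y) := by
  obtain ⟨h0, hr0, he0⟩ := Ric_eq H
  have hE : Reg a b U 4 0 (fun x y => 3/4 * ((n : ℝ) - 1) * (e00 a b x y * e00 a b x y)) :=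
    ((Reg.e00 H).mul' (Reg.e00 H)).cmul _
  have hRic : Reg a b U 2 2 (RicciC (RF a b)) :=
    ((hE.mul' (Reg.Fip 2)).add (hr0.mono (by norm_num))).congr he0.symm
  have st1 := fun i => poleD H i 1 hE (hr0.cast (by norm_num) le_rfl) one_ne_zero he0
  choose h1 hr1 he1 using st1
  have hX1 : ∀ j, Reg a b U 4 0 (fun x y => -((1 + 1 : ℕ) : ℝ) *
     (3/4 * ((n : ℝ) - 1) * (e00 a b x y * e00 a b x y)) * Fy a b j x y) := fun j =>
    (hE.cmul _).mul' (Reg.Fy H j)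
  have st2 := fun i j => poleD H i 2 (hX1 j) ((hr1 j).cast (by norm_num) le_rfl) two_ne_zero (he1 j)
  choose h2 hr2 he2 using st2
  have hal : Reg a b U 1 0 (ralpha a) := Reg.al
  have hc : Reg a b U 1 0 (fun x y => bnormsq a b x * ralpha a x y + rbeta b x y) :=
    ((Reg.coef _ H.b2_smooth).mul' hal).add (Reg.beta H)
  refine ⟨fun x y => (1/2) * ((ralpha a x y * (RF a b x y)⁻¹ ^ 1) * ∑ i, ∑ j, (a x)⁻¹ i j * h2 i j x y)
     - (ralpha a x y * (RF a b x y)⁻¹ ^ 2) * (∑ i, up a x (b x) i * h1 i x y)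
     + ((bnormsq a b x * ralpha a x y + rbeta b x y) * (RF a b x y)⁻¹ ^ 3) * h0 x y
     + 9 * ((3/4 * ((n : ℝ) - 1) * (e00 a b x y * e00 a b x y)) * (RF a b x y)⁻¹ ^ 4), ?_, ?_⟩
  · refine Reg.add (Reg.add (Reg.sub (Reg.cmul _ ?_) ?_) ?_) (Reg.cmul _ ?_)
    · refine (hal.mul' (Reg.Fip 1) (k'' := 0) (m'' := 1)).mul' (k' := 0) (m' := 3)
        (Reg.sum _ fun i _ => Reg.sum _ fun j _ => ?_)
      exact (Reg.coef _ (H.ainv_smooth i j)).mul' (hr2 i j)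
    · refine (hal.mul' (Reg.Fip 2) (k'' := -1) (m'' := 2)).mul' (k' := 1) (m' := 2)
        (Reg.sum _ fun i _ => ?_)
      exact (Reg.B H i).mul' (hr1 i)
    · exact (hc.mul' (Reg.Fip 3) (k'' := -2) (m'' := 3)).mul' hr0
    · exact hE.mul' (Reg.Fip 4)
  · intro x hx y hy
    -- Euler relations
    have E1 : ∑ i, dy i (RicciC (RF a b)) x y * y i = 2 * RicciC (RF a b) x y := by
      simpa using hRic.euler H hx hy
    have E2 : ∀ j, ∑ i, dy i (fun x' y' => dy j (RicciC (RF a b)) x' y') x y * y i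
        = dy j (RicciC (RF a b)) x y := by
      intro j; 
      have := (hRic.dy H j).euler H hx hy
      norm_num at this
      exact this
    have E3 : ∀ i, ∑ j, dy i (fun x' y' => dy j (RicciC (RF a b)) x' y') x y * y j
        = dy i (RicciC (RF a b)) x y := by
      intro i
      have sR : ∀ j, Sm U (dy j (RicciC (RF a b))) := fun j => (hRic.dy H j).sm H
      have q : EqD U (fun x y => ∑ j, dy j (RicciC (RF a b)) x y * y j)
          (fun x y => RicciC (RF a b) x y + RicciC (RF a b) x y) := fun x hx y hy => by
        have := hRic.euler H hx hy
        beta_reduce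
        rw [this]; push_cast; ring
      have q2 := q.dy i x hx y hy
      rw [dy_sum' _ H.hU (fun j _ => (sR j).mul (Sm.yc j)) i hx hy,
        dy_add' H.hU (hRic.sm H) (hRic.sm H) i hx hy] at q2
      have q3 : ∀ j, dy i (fun x y => dy j (RicciC (RF a b)) x y * y j) x y =
         dy i (fun x' y' => dy j (RicciC (RF a b)) x' y') x y * y j
          + dy j (RicciC (RF a b)) x y * if j = i then 1 else 0 := by
        intro j
        rw [dy_mul' H.hU (sR j) (Sm.yc j) i hx hy, dy_yc]
      simp_rw [q3, Finset.sum_add_distrib] at q2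
      simp at q2
      exact q2
    have hg := (ginv_eq H hx hy).2.2
    have r1 : scalarCurv (RF a b) x y =
       (1/2) * (ralpha a x y * (RF a b x y)⁻¹ ^ 1 *
          ∑ i, ∑ j, (a x)⁻¹ i j * dy i (fun x' y' => dy j (RicciC (RF a b)) x' y') x y)
       - (1/2) * (ralpha a x y * (RF a b x y)⁻¹ ^ 2) *
          ((∑ i, up a x (b x) i * ∑ j, dy i (fun x' y' => dy j (RicciC (RF a b)) x' y') x y * y j)
          + ∑ j, up a x (b x) j * ∑ i, dy i (fun x' y' => dy j (RicciC (RF a b)) x' y') x y * y i)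
       + (1/2) * ((bnormsq a b x * ralpha a x y + rbeta b x y) * (RF a b x y)⁻¹ ^ 3) *
          ∑ j, (∑ i, dy i (fun x' y' => dy j (RicciC (RF a b)) x' y') x y * y i) * y j := by
      simp only [scalarCurv, RicciTensor, hg]
      rw [pow_one]
      exact rearr _ _ _ (fun i j => (a x)⁻¹ i j) (fun i j => dy i (fun x' y' => dy j (RicciC (RF a b)) x' y') x y) (up a x (b x)) y
    simp_rw [E3, E2, E1] at r1
    have D1 : ∀ i, dy i (RicciC (RF a b)) x y = _ := fun i => he1 i x hx y hy
    have D2 : ∀ i j, dy i (fun x' y' => dy j (RicciC (RF a b)) x' y') x y = _ :=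
      fun i j => he2 i j x hx y hy
    have D0 : RicciC (RF a b) x y = _ := he0 x hx y hy
    have S2 : ∑ i, ∑ j, (a x)⁻¹ i j * dy i (fun x' y' => dy j (RicciC (RF a b)) x' y') x y =
        6 * (3/4 * ((n : ℝ) - 1) * (e00 a b x y * e00 a b x y)) * (RF a b x y)⁻¹ ^ 4 *
          (∑ i, Fy a b i x y * up a x (fun j => Fy a b j x y) i)
        + ∑ i, ∑ j, (a x)⁻¹ i j * h2 i j x y := by
      rw [Finset.mul_sum, ← Finset.sum_add_distrib]
      refine Finset.sum_congr rfl fun i _ => ?_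
      rw [up, Finset.mul_sum, Finset.mul_sum, ← Finset.sum_add_distrib]
      refine Finset.sum_congr rfl fun j _ => ?_
      rw [D2]; push_cast; ring
    have S1 : ∑ i, up a x (b x) i * dy i (RicciC (RF a b)) x y =
        -2 * (3/4 * ((n : ℝ) - 1) * (e00 a b x y * e00 a b x y)) * (RF a b x y)⁻¹ ^ 3 *
          (∑ i, up a x (b x) i * Fy a b i x y) + ∑ i, up a x (b x) i * h1 i x y := by
      rw [Finset.mul_sum, ← Finset.sum_add_distrib]
      refine Finset.sum_congr rfl fun i _ => ?_
      rw [D1]; push_cast; ring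
    have hA := H.ane x hx y hy
    have hF := H.Fne x hx y hy
    have c0 : ∑ i, up a x (b x) i * yl a i x y = rbeta b x y := by
      have := H.yl_up hx y (b x)
      simp_rw [mul_comm (up a x (b x) _), this, rbeta, mul_comm]
    have c1 : ∑ i, up a x (b x) i * Fy a b i x y = rbeta b x y * (ralpha a x y)⁻¹ + bnormsq a b x := by
      rw [bnormsq_eq, ← c0, Finset.sum_mul, ← Finset.sum_add_distrib]
      refine Finset.sum_congr rfl fun i _ => ?_
      simp only [Fy]; ring
    have c2 : ∀ i, up a x (fun j => Fy a b j x y) i = y i * (ralpha a x y)⁻¹ + up a x (b x) i := by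
      intro i
      rw [← H.up_yl hx y i]
      simp only [up]
      rw [Finset.sum_mul, ← Finset.sum_add_distrib]
      refine Finset.sum_congr rfl fun i _ => ?_
      simp only [Fy]; ring
    have c3 : ∑ i, Fy a b i x y * up a x (fun j => Fy a b j x y) i =
        1 + 2 * rbeta b x y * (ralpha a x y)⁻¹ + bnormsq a b x := by
      simp_rw [c2]
      have : ∑ i, Fy a b i x y * (y i * (ralpha a x y)⁻¹ + up a x (b x) i) =
          (∑ i, yl a i x y * y i) * (ralpha a x y)⁻¹ ^ 2 + (∑ i, b x i * y i) * (ralpha a x y)⁻¹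
          + ∑ i, up a x (b x) i * Fy a b i x y := by
        rw [Finset.sum_mul, Finset.sum_mul, ← Finset.sum_add_distrib, ← Finset.sum_add_distrib]
        refine Finset.sum_congr rfl fun i _ => ?_
        simp only [Fy]; ring
      have f5 : ∑ i, b x i * y i = rbeta b x y := rfl
      rw [this, H.yl_y hx hy, c1, f5]
      field_simp; ring
    have hFd : rbeta b x y = RF a b x y - ralpha a x y := by simp [RF]
    rw [r1, S2, S1, c1, c3, D0]
    beta_reduce
    simp only [hFd]
    generalize (e00 a b x y * e00 a b x y) = E
    generalize ∑ i, ∑ j, (a x)⁻¹ i j * h2 i j x y = Z2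
    generalize ∑ i, up a x (b x) i * h1 i x y = Z1
    field_simp
    ring

end ric

section poly
open Polynomial

lemma poly_core (p : ℝ) (hp : 0 < p) (b0 b1 e0 e1 e2 c : ℝ) (hb : b0 ≠ 0) (hc : c ≠ 0)
    (P Q A : ℝ[X]) (j : ℕ) (al : ℝ → ℝ)
    (hA : A = C p * (X ^ 2 + 1) + (C b0 + C b1 * X) ^ 2)
    (hal : ∀ t, al t ^ 2 = A.eval t)
    (h : ∀ t, c * al t * (A.eval t) ^ j * (e0 + e1 * t + e2 * t ^ 2) ^ 2 =
      (P.eval t + al t * Q.eval t) * (al t + (b0 + b1 * t))) :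
    e1 = 0 ∧ e0 = e2 := by
  set q : ℝ[X] := X ^ 2 + 1 with hq
  set B : ℝ[X] := C b0 + C b1 * X with hB
  set E : ℝ[X] := C e0 + C e1 * X + C e2 * X ^ 2 with hE
  set X0 : ℝ[X] := C c * A ^ (j + 1) * E ^ 2 - C p * q * P with hX0
  set Y : ℝ[X] := C p * q * Q + C c * B * A ^ j * E ^ 2 with hY
  have hXY : ∀ t, X0.eval t = al t * Y.eval t := by
    intro t
    have h1 := h t
    have h2 := hal t
    have h3 : A.eval t = p * q.eval t + B.eval t ^ 2 := by rw [hA]; simp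
    have h4 : B.eval t = b0 + b1 * t := by simp [hB]
    have h5 : E.eval t = e0 + e1 * t + e2 * t ^ 2 := by simp [hE]
    rw [← h4, ← h5] at h1
    simp only [hX0, hY, eval_sub, eval_add, eval_mul, eval_pow, eval_C]
    have h6 : p * q.eval t = al t ^ 2 - B.eval t ^ 2 := by rw [h2, h3]; ring
    rw [h6, pow_succ, ← h2]
    rw [← h2] at h1
    linear_combination (al t - B.eval t) * h1
  have hsq : X0 ^ 2 = A * Y ^ 2 := by
    apply Polynomial.funext
    intro t
    simp only [eval_pow, eval_mul]
    rw [hXY, ← hal]; ring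
  have hqpos : ∀ t, 0 < q.eval t := fun t => by simp [hq]; positivity
  have hApos : ∀ t, 0 < A.eval t := fun t => by
    rw [hA]; simp only [eval_add, eval_mul, eval_C, eval_pow]
    have := hqpos t
    positivity
  have hAdeg : A.natDegree = 2 := by
    have : A = C (p + b1 ^ 2) * X ^ 2 + C (2 * b0 * b1) * X + C (p + b0 ^ 2) := by
      rw [hA, hq, hB]; simp only [C_add, C_mul, C_pow]
      simp only [map_ofNat]; ring
    rw [this]
    exact natDegree_quadratic (by positivity)
  have hY0 : Y = 0 := by
    by_contra hne
    have hd : Y ∣ X0 := by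
      have : Y ^ 2 ∣ X0 ^ 2 := ⟨A, by rw [hsq]; ring⟩
      exact (IsIntegrallyClosed.pow_dvd_pow_iff two_ne_zero).mp this
    obtain ⟨Z, hZ⟩ := hd
    have hAZ : A = Z ^ 2 := by
      have : Y ^ 2 * A = Y ^ 2 * Z ^ 2 := by rw [mul_comm, ← hsq, hZ]; ring
      exact mul_left_cancel₀ (pow_ne_zero _ hne) this
    have hZd : Z.natDegree = 1 := by
      rw [hAZ, natDegree_pow] at hAdeg; omega
    obtain ⟨r, hr⟩ := exists_root_of_degree_eq_one (degree_eq_iff_natDegree_eq_of_pos one_pos |>.mpr hZd)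
    have := hApos r
    rw [hAZ, eval_pow, hr.eq_zero] at this
    norm_num at this
  have hX00 : X0 = 0 := by
    rw [hY0] at hsq; simpa using hsq
  have hqm : q.Monic := by rw [hq]; monicity!
  have hqd : q.natDegree = 2 := by rw [hq]; compute_degree!
  have hqirr : Irreducible q := by
    rw [hqm.irreducible_iff_roots_eq_zero_of_degree_le_three (by omega) (by omega)]
    rw [Multiset.eq_zero_iff_forall_notMem]
    intro r hr
    have := (mem_roots hqm.ne_zero).mp hr
    exact (hqpos r).ne' this
  have hqp : Prime q := hqirr.prime
  have lowdeg : ∀ R : ℝ[X], R.natDegree ≤ 1 → q ∣ R → R = 0 := by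
    intro R hR hd
    by_contra hne
    have := natDegree_le_of_dvd hd hne
    omega
  have hqA : ¬ q ∣ A := by
    intro hd
    have h1 : q ∣ B ^ 2 := by
      have : B ^ 2 = A - q * C p := by rw [hA]; ring
      rw [this]; exact dvd_sub hd (dvd_mul_right _ _)
    have h2 := lowdeg B (by rw [hB]; compute_degree) (hqp.dvd_of_dvd_pow h1)
    have h3 := congrArg (eval 0) h2
    simp [hB] at h3
    exact hb h3
  have hqE : q ∣ E := by
    have h1 : q ∣ A ^ (j + 1) * E ^ 2 := by
      have : A ^ (j + 1) * E ^ 2 = q * (C c⁻¹ * C p * P) := by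
        have h2 : C c * A ^ (j + 1) * E ^ 2 = C p * q * P := sub_eq_zero.mp (hX0 ▸ hX00)
        have h3 : C c⁻¹ * C c = 1 := by rw [← C_mul, inv_mul_cancel₀ hc, C_1]
        linear_combination C c⁻¹ * h2 - (A ^ (j + 1) * E ^ 2) * h3
      rw [this]; exact dvd_mul_right _ _
    rcases hqp.dvd_or_dvd h1 with h2 | h2
    · exact absurd (hqp.dvd_of_dvd_pow h2) hqA
    · exact hqp.dvd_of_dvd_pow h2
  have h0 : C (e0 - e2) + C e1 * X = 0 := by
    apply lowdeg
    · compute_degree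
    · have : C (e0 - e2) + C e1 * X = E - q * C e2 := by rw [hE, hq, C_sub]; ring
      rw [this]; exact dvd_sub hqE (dvd_mul_right _ _)
  have k0 := congrArg (eval 0) h0
  have k1 := congrArg (eval 1) h0
  simp at k0 k1
  constructor <;> linarith

end poly

section quad
variable {n : ℕ}

def IsL (f : Vec n → ℝ) : Prop := ∃ w : Vec n, ∀ y, f y = ∑ i, w i * y i
def IsQ (f : Vec n → ℝ) : Prop := ∃ M : Fin n → Fin n → ℝ, ∀ y, f y = ∑ i, ∑ j, M i j * y i * y j

lemma IsL.add {f g : Vec n → ℝ} : IsL f → IsL g → IsL (fun y => f y + g y)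
  | ⟨w, hw⟩, ⟨v, hv⟩ => ⟨fun i => w i + v i, fun y => by
    beta_reduce
    rw [hw, hv, ← Finset.sum_add_distrib]; exact Finset.sum_congr rfl fun i _ => by ring⟩
lemma IsL.cmul {f : Vec n → ℝ} (c : ℝ) : IsL f → IsL (fun y => c * f y)
  | ⟨w, hw⟩ => ⟨fun i => c * w i, fun y => by
    beta_reduce
    rw [hw, Finset.mul_sum]; exact Finset.sum_congr rfl fun i _ => by ring⟩
lemma IsL.coord (i : Fin n) : IsL (fun y => y i) := ⟨fun j => if j = i then 1 else 0, fun y => by simp⟩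
lemma IsL.sum {f : Fin n → Vec n → ℝ} (h : ∀ i, IsL (f i)) : IsL (fun y => ∑ i, f i y) := by
  choose w hw using h
  refine ⟨fun j => ∑ i, w i j, fun y => ?_⟩
  simp_rw [hw, Finset.sum_mul]; exact Finset.sum_comm
lemma IsL.lin {f : Vec n → ℝ} (h : IsL f) (u v : Vec n) (s t : ℝ) :
    f (s • u + t • v) = s * f u + t * f v := by
  obtain ⟨w, hw⟩ := h
  simp only [hw, Finset.mul_sum, ← Finset.sum_add_distrib]
  exact Finset.sum_congr rfl fun i _ => by simp; ring
lemma IsL.mul {f g : Vec n → ℝ} : IsL f → IsL g → IsQ (fun y => f y * g y)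
  | ⟨w, hw⟩, ⟨v, hv⟩ => ⟨fun i j => w i * v j, fun y => by
    beta_reduce
    rw [hw, hv, Finset.sum_mul_sum]
    exact Finset.sum_congr rfl fun i _ => Finset.sum_congr rfl fun j _ => by ring⟩
lemma IsQ.add {f g : Vec n → ℝ} : IsQ f → IsQ g → IsQ (fun y => f y + g y)
  | ⟨w, hw⟩, ⟨v, hv⟩ => ⟨fun i j => w i j + v i j, fun y => by
    beta_reduce
    rw [hw, hv]; simp_rw [← Finset.sum_add_distrib]
    exact Finset.sum_congr rfl fun i _ => Finset.sum_congr rfl fun j _ => by ring⟩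
lemma IsQ.cmul {f : Vec n → ℝ} (c : ℝ) : IsQ f → IsQ (fun y => c * f y)
  | ⟨w, hw⟩ => ⟨fun i j => c * w i j, fun y => by
    beta_reduce
    rw [hw]; simp_rw [Finset.mul_sum]
    exact Finset.sum_congr rfl fun i _ => Finset.sum_congr rfl fun j _ => by ring⟩
lemma IsQ.sub {f g : Vec n → ℝ} (hf : IsQ f) (hg : IsQ g) : IsQ (fun y => f y - g y) := by
  simpa [sub_eq_add_neg] using hf.add (hg.cmul (-1))
lemma IsQ.sum {f : Fin n → Vec n → ℝ} (h : ∀ i, IsQ (f i)) : IsQ (fun y => ∑ i, f i y) := by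
  choose w hw using h
  refine ⟨fun j k => ∑ i, w i j k, fun y => ?_⟩
  simp_rw [hw, Finset.sum_mul]
  rw [Finset.sum_comm]
  exact Finset.sum_congr rfl fun i _ => Finset.sum_comm
/-- polarization -/
def pol (f : Vec n → ℝ) (u v : Vec n) : ℝ := f (u + v) - f u - f v
lemma IsQ.line {f : Vec n → ℝ} (h : IsQ f) (u v : Vec n) (s t : ℝ) :
    f (s • u + t • v) = s ^ 2 * f u + s * t * pol f u v + t ^ 2 * f v := by
  obtain ⟨w, hw⟩ := h
  simp only [pol, hw, Finset.mul_sum, ← Finset.sum_add_distrib, ← Finset.sum_sub_distrib]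
  exact Finset.sum_congr rfl fun i _ => Finset.sum_congr rfl fun j _ => by simp; ring
end quad

section iso
variable {n : ℕ} {a : Vec n → Matrix (Fin n) (Fin n) ℝ} {b : Vec n → Vec n} {U : Set (Vec n)}

lemma Reg.poly (H : RD a b U) {x : Vec n} (hx : x ∈ U) (u v : Vec n) (huv : ∀ t : ℝ, u + t • v ≠ 0)
    (A : Polynomial ℝ) (hA : ∀ t, ralpha a x (u + t • v) ^ 2 = A.eval t)
    {k m f} (h : Reg a b U k m f) (hm : m = 0) :
    ∃ (P Q : Polynomial ℝ) (j : ℕ), ∀ t, f x (u + t • v) * (A.eval t) ^ j =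
      P.eval t + ralpha a x (u + t • v) * Q.eval t := by
  induction h with
  | coef c hc => exact ⟨Polynomial.C (c x), 0, 0, fun t => by simp⟩
  | yc i => exact ⟨Polynomial.C (u i) + Polynomial.C (v i) * Polynomial.X, 0, 0, fun t => by
      simp; ring⟩
  | al => exact ⟨0, 1, 0, fun t => by simp⟩
  | ali => exact ⟨0, 1, 1, fun t => by
      have := H.ane x hx _ (huv t)
      rw [← hA]; simp; field_simp⟩
  | Fi => exact absurd hm one_ne_zero
  | zero k => exact ⟨0, 0, 0, fun t => by simp⟩
  | add hf hg ihf ihg =>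
    obtain ⟨P, Q, j, h1⟩ := ihf hm
    obtain ⟨P', Q', j', h2⟩ := ihg hm
    refine ⟨P * A ^ j' + P' * A ^ j, Q * A ^ j' + Q' * A ^ j, j + j', fun t => ?_⟩
    simp only [Polynomial.eval_add, Polynomial.eval_mul, Polynomial.eval_pow]
    rw [pow_add]
    linear_combination (A.eval t) ^ j' * h1 t + (A.eval t) ^ j * h2 t
  | mul hf hg ihf ihg =>
    obtain ⟨P, Q, j, h1⟩ := ihf (by omega)
    obtain ⟨P', Q', j', h2⟩ := ihg (by omega)
    refine ⟨P * P' + A * Q * Q', P * Q' + P' * Q, j + j', fun t => ?_⟩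
    simp only [Polynomial.eval_add, Polynomial.eval_mul]
    rw [pow_add, mul_mul_mul_comm, h1, h2, ← hA]; ring
  | mono hf h ih => exact ih (by omega)
  | congr hf h ih =>
    obtain ⟨P, Q, j, h1⟩ := ih hm
    exact ⟨P, Q, j, fun t => by rw [← h x hx _ (huv t)]; exact h1 t⟩

lemma e00_clear (H : RD a b U) (θ : Vec n → Vec n) (μ : Vec n → ℝ)
    (hθ : ∀ i, ContDiffOn ℝ ∞ (fun x => θ x i) U) (hμ : ContDiffOn ℝ ∞ μ U)
    (hw : ∀ x ∈ U, ∀ y : Vec n, y ≠ 0 → scalarCurv (RF a b) x y =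
        (n : ℝ) * ((n : ℝ) - 1) * ((∑ i, θ x i * y i) / RF a b x y + μ x)) :
    ∃ g, Reg a b U 4 0 g ∧ ∀ x ∈ U, ∀ y : Vec n, y ≠ 0 →
      (9/2) * ((n : ℝ) - 1) * (1 - bnormsq a b x) * ralpha a x y * (e00 a b x y) ^ 2 =
        g x y * RF a b x y := by
  obtain ⟨h, hr, he⟩ := scal_eq H
  have hθr : Reg a b U 1 0 (fun x y => ∑ i, θ x i * y i) :=
    Reg.sum _ fun i _ => (Reg.coef _ (hθ i)).mul' (Reg.yc i)
  have h1 : Reg a b U 0 4 (fun x y => h x y - ((n : ℝ) * ((n : ℝ) - 1)) *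
      ((∑ i, θ x i * y i) * (RF a b x y)⁻¹ + μ x)) := by
    refine hr.sub (Reg.cmul _ (Reg.add ?_ ?_))
    · exact hθr.mul' Reg.Fi (by norm_num) (by norm_num)
    · exact (Reg.coef μ hμ).mono (by norm_num)
  obtain ⟨g, hg, hg2⟩ := h1.clear H
  refine ⟨g, hg.cast (by norm_num) le_rfl, fun x hx y hy => ?_⟩
  have h2 := hg2 x hx y hy
  have h3 := he x hx y hy
  have hF := H.Fne x hx y hy
  rw [hw x hx y hy] at h3
  beta_reduce at h2 h3
  rw [← h2]
  rw [div_eq_mul_inv] at h3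
  have h4 : RF a b x y * (RF a b x y)⁻¹ = 1 := mul_inv_cancel₀ hF
  generalize (RF a b x y)⁻¹ = Fi at *
  have h5 : Fi ^ 5 * RF a b x y ^ 5 = 1 := by rw [← mul_pow, mul_comm, h4, one_pow]
  linear_combination (RF a b x y ^ 5) * h3 - ((9/2) * ((n : ℝ) - 1) * (1 - bnormsq a b x) * ralpha a x y * (e00 a b x y) ^ 2) * h5

lemma isL_beta (x : Vec n) : IsL (rbeta b x) := ⟨b x, fun _ => rfl⟩
lemma isL_Bx (x : Vec n) (m : Fin n) : IsL (Bx b m x) := ⟨_, fun _ => rfl⟩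
lemma isL_sl (x : Vec n) (l : Fin n) : IsL (sl b l x) := by
  have h1 : IsL (fun y : Vec n => ∑ m, pd m (fun x => b x l) x * y m) := ⟨_, fun _ => rfl⟩
  have h2 := (h1.add ((isL_Bx (b := b) x l).cmul (-1))).cmul (1/2)
  convert h2 using 2
  simp only [sl]; ring
lemma isL_s0 (x : Vec n) : IsL (s0 a b x) := IsL.sum fun l => (isL_sl x l).cmul _
lemma isQ_Ax (x : Vec n) (l : Fin n) : IsQ (Ax a l x) := ⟨_, fun _ => rfl⟩
lemma isQ_A (x : Vec n) : IsQ (fun y => ∑ i, ∑ j, a x i j * y i * y j) := ⟨_, fun _ => rfl⟩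
lemma isQ_Gl (x : Vec n) (l : Fin n) : IsQ (Gl a l x) :=
  IsQ.cmul _ ((IsQ.sum fun m => IsL.mul ⟨_, fun _ => rfl⟩ (IsL.coord m)).sub ((isQ_Ax x l).cmul _))
lemma isQ_e00 (x : Vec n) : IsQ (e00 a b x) :=
  ((IsQ.sum fun m => (isL_Bx x m).mul (IsL.coord m)).sub
    ((IsQ.sum fun l => (isQ_Gl x l).cmul _).cmul 2)).add (((isL_beta x).mul (isL_s0 x)).cmul 2)

/-- the form `α² - β²`. -/
def qf (a : Vec n → Matrix (Fin n) (Fin n) ℝ) (b : Vec n → Vec n) (x y : Vec n) : ℝ :=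
  (∑ i, ∑ j, a x i j * y i * y j) - rbeta b x y * rbeta b x y

lemma isQ_qf (x : Vec n) : IsQ (qf a b x) := (isQ_A x).sub ((isL_beta x).mul (isL_beta x))

lemma beta_neg (x y : Vec n) : rbeta b x (-y) = - rbeta b x y := by simp [rbeta]
lemma alpha_neg (x y : Vec n) : ralpha a x (-y) = ralpha a x y := by simp [ralpha]

lemma RD.beta_lt (H : RD a b U) {x y : Vec n} (hx : x ∈ U) (hy : y ≠ 0) :
    |rbeta b x y| < ralpha a x y := by
  have h1 := H.Fpos x hx y hy
  have h2 := H.Fpos x hx (-y) (neg_ne_zero.mpr hy)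
  simp only [beta_neg, alpha_neg] at h1 h2
  rw [abs_lt]; constructor <;> linarith

lemma RD.qf_eq (H : RD a b U) {x y : Vec n} (hx : x ∈ U) (hy : y ≠ 0) :
    qf a b x y = ralpha a x y ^ 2 - rbeta b x y ^ 2 := by
  rw [qf, ralpha, Real.sq_sqrt (H.pos x hx y hy).le]; ring

lemma RD.qf_pos (H : RD a b U) {x y : Vec n} (hx : x ∈ U) (hy : y ≠ 0) : 0 < qf a b x y := by
  rw [H.qf_eq hx hy]
  have := sq_lt_sq' (neg_lt_of_abs_lt (H.beta_lt hx hy)) (lt_of_abs_lt (H.beta_lt hx hy))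
  linarith

lemma iso_point (hn : 2 ≤ n) (H : RD a b U) {g : Vec n → Vec n → ℝ} (hg : Reg a b U 4 0 g)
    (hge : ∀ x ∈ U, ∀ y : Vec n, y ≠ 0 →
      (9/2) * ((n : ℝ) - 1) * (1 - bnormsq a b x) * ralpha a x y * (e00 a b x y) ^ 2 =
        g x y * RF a b x y) {x : Vec n} (hx : x ∈ U) (u : Vec n) (hu : rbeta b x u ≠ 0) (y : Vec n) :
    e00 a b x y * qf a b x u = e00 a b x u * qf a b x y := by
  have hu0 : u ≠ 0 := by rintro rfl; simp [rbeta] at hu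
  have hp := H.qf_pos hx hu0
  -- key step
  have key : ∀ v : Vec n, pol (qf a b x) u v = 0 → qf a b x v = qf a b x u →
      pol (e00 a b x) u v = 0 ∧ e00 a b x u = e00 a b x v := by
    intro v hv1 hv2
    have hq : ∀ t : ℝ, qf a b x (u + t • v) = qf a b x u * (t ^ 2 + 1) := by
      intro t
      have := (isQ_qf (a := a) (b := b) x).line u v 1 t
      rw [one_smul, hv1, hv2] at this
      rw [this]; ring
    have hne : ∀ t : ℝ, u + t • v ≠ 0 := by
      intro t h0
      have := hq t
      rw [h0] at this
      have h1 : qf a b x 0 = 0 := by simp [qf, rbeta]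
      rw [h1] at this
      have : 0 < qf a b x u * (t ^ 2 + 1) := by positivity
      linarith
    have hbt : ∀ t : ℝ, rbeta b x (u + t • v) = rbeta b x u + rbeta b x v * t := by
      intro t
      have := (isL_beta (b := b) x).lin u v 1 t
      rw [one_smul] at this
      rw [this]; ring
    have het : ∀ t : ℝ, e00 a b x (u + t • v) = e00 a b x u + pol (e00 a b x) u v * t + e00 a b x v * t ^ 2 := by
      intro t
      have := (isQ_e00 (a := a) (b := b) x).line u v 1 t
      rw [one_smul] at this
      rw [this]; ring
    let A : Polynomial ℝ := Polynomial.C (qf a b x u) * (Polynomial.X ^ 2 + 1) +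
      (Polynomial.C (rbeta b x u) + Polynomial.C (rbeta b x v) * Polynomial.X) ^ 2
    have hA : ∀ t, ralpha a x (u + t • v) ^ 2 = A.eval t := by
      intro t
      have h1 := H.qf_eq hx (hne t)
      rw [hq, hbt] at h1
      simp only [A, Polynomial.eval_add, Polynomial.eval_mul, Polynomial.eval_pow, Polynomial.eval_C,
        Polynomial.eval_X, Polynomial.eval_one]
      linarith
    obtain ⟨P, Q, j, hPQ⟩ := hg.poly H hx u v hne A hA rfl
    refine poly_core (qf a b x u) hp (rbeta b x u) (rbeta b x v) _ _ _
      ((9/2) * ((n : ℝ) - 1) * (1 - bnormsq a b x)) hu ?_ P Q A j _ rfl hA ?_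
    · have h1 : (2 : ℝ) ≤ n := by exact_mod_cast hn
      have h2 := H.b2 x hx
      have : 0 < (9/2) * ((n : ℝ) - 1) * (1 - bnormsq a b x) :=
        mul_pos (by linarith) (by linarith)
      exact this.ne'
    · intro t
      have h1 := hge x hx _ (hne t)
      rw [het] at h1
      rw [← hPQ t, ← hbt t]
      change _ = _ * RF a b x (u + t • v)
      linear_combination (A.eval t) ^ j * h1
  -- decompose
  set s : ℝ := pol (qf a b x) u y / (2 * qf a b x u) with hs
  set w : Vec n := y - s • u with hw
  have hyd : ∀ f : Vec n → ℝ, IsQ f → f w = s ^ 2 * f u - s * pol f u y + f y := by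
    intro f hf
    have := hf.line u y (-s) 1
    rw [one_smul] at this
    have e : w = -s • u + y := by rw [hw, neg_smul]; abel
    rw [e, this]; ring
  have hpolw : ∀ f : Vec n → ℝ, IsQ f → pol f u w = pol f u y - 2 * s * f u := by
    intro f hf
    have h1 := hf.line u y (1 - s) 1
    have h3 := hyd f hf
    have e : u + w = (1 - s) • u + (1:ℝ) • y := by rw [hw, sub_smul, one_smul, one_smul]; abel
    rw [pol, e, h1, h3]; ring
  have hQ := isQ_qf (a := a) (b := b) x
  have hE := isQ_e00 (a := a) (b := b) x
  have hpw : pol (qf a b x) u w = 0 := by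
    rw [hpolw _ hQ, hs]; field_simp; ring
  by_cases hw0 : w = 0
  · have : y = s • u + (0 : ℝ) • u := by rw [zero_smul, add_zero, ← sub_eq_zero, ← hw, hw0]
    rw [this, hQ.line, hE.line]; ring
  have hqw := H.qf_pos hx hw0
  set r : ℝ := Real.sqrt (qf a b x u / qf a b x w) with hr
  have hr2 : r ^ 2 = qf a b x u / qf a b x w := Real.sq_sqrt (by positivity)
  have hr0 : r ≠ 0 := by
    intro h; rw [h] at hr2
    have : 0 < qf a b x u / qf a b x w := by positivity
    linarith
  have hsc : ∀ f : Vec n → ℝ, IsQ f → f (r • w) = r ^ 2 * f w := by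
    intro f hf
    have := hf.line u w 0 r
    simpa using this
  have hscp : ∀ f : Vec n → ℝ, IsQ f → pol f u (r • w) = r * pol f u w := by
    intro f hf
    have := hf.line u w 1 r
    rw [one_smul] at this
    rw [pol, this, hsc f hf]; ring
  obtain ⟨k1, k2⟩ := key (r • w) (by rw [hscp _ hQ, hpw, mul_zero])
    (by rw [hsc _ hQ, hr2]; field_simp)
  rw [hscp _ hE] at k1
  have k3 : pol (e00 a b x) u w = 0 := by
    rcases mul_eq_zero.mp k1 with h | h
    · exact absurd h hr0
    · exact h
  rw [hsc _ hE, hr2] at k2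
  rw [hpolw _ hE] at k3
  rw [hpolw _ hQ] at hpw
  have k4 := hyd _ hE
  have k5 := hyd _ hQ
  have k6 : e00 a b x u * qf a b x w = qf a b x u * e00 a b x w := by
    field_simp at k2; linarith
  rw [k4, k5] at k6
  linear_combination -k6 + (s * qf a b x u) * k3 - s * e00 a b x u * hpw

lemma iso_all (hn : 2 ≤ n) (H : RD a b U) {g : Vec n → Vec n → ℝ} (hg : Reg a b U 4 0 g)
    (hge : ∀ x ∈ U, ∀ y : Vec n, y ≠ 0 →
      (9/2) * ((n : ℝ) - 1) * (1 - bnormsq a b x) * ralpha a x y * (e00 a b x y) ^ 2 =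
        g x y * RF a b x y) {x : Vec n} (hx : x ∈ U) (y z : Vec n) (hy : y ≠ 0) (hz : z ≠ 0) :
    e00 a b x y * qf a b x z = e00 a b x z * qf a b x y := by
  -- at points with b ≠ 0
  have h1 : ∀ x ∈ U, b x ≠ 0 → e00 a b x y * qf a b x z - e00 a b x z * qf a b x y = 0 := by
    intro x hx hb
    obtain ⟨i, hi⟩ := Function.ne_iff.mp hb
    have hu : rbeta b x (Pi.single i 1) ≠ 0 := by simpa [rbeta, Pi.single_apply] using hi
    have hu0 : (Pi.single i 1 : Vec n) ≠ 0 := by simp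
    have p1 := iso_point hn H hg hge hx _ hu y
    have p2 := iso_point hn H hg hge hx _ hu z
    have hp := (H.qf_pos hx hu0).ne'
    apply mul_left_cancel₀ hp
    linear_combination qf a b x z * p1 - qf a b x y * p2
  by_cases hcl : x ∈ closure {x' | x' ∈ U ∧ b x' ≠ 0}
  · have hc : ContinuousOn (fun x => e00 a b x y * qf a b x z - e00 a b x z * qf a b x y) U := by
      have hs : ∀ y : Vec n, y ≠ 0 → ContinuousOn (fun x => e00 a b x y) U := fun y hy x hx =>
        (((Reg.e00 H).sm H).diffx H.hU hx hy).continuousAt.continuousWithinAt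
      have hq : ∀ y : Vec n, ContinuousOn (fun x => qf a b x y) U := fun y => by
        have c1 : ContinuousOn (fun x => rbeta b x y) U :=
          continuousOn_finset_sum _ fun i _ => (H.hb i).continuousOn.mul continuousOn_const
        exact (continuousOn_finset_sum _ fun i _ => continuousOn_finset_sum _ fun j _ =>
          ((H.ha i j).continuousOn.mul continuousOn_const).mul continuousOn_const).sub (c1.mul c1)
      exact ((hs y hy).mul (hq z)).sub ((hs z hz).mul (hq y))
    have hca := hc.continuousAt (H.hU.mem_nhds hx)
    have := mem_closure_iff_frequently.mp hcl
    have hfin : (fun x => e00 a b x y * qf a b x z - e00 a b x z * qf a b x y) x = 0 := by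
      by_contra hne
      have := hca.eventually_ne hne
      obtain ⟨x', hx', hx''⟩ := (‹∃ᶠ _ in _, _›.and_eventually this).exists
      exact hx'' (h1 x' hx'.1 hx'.2)
    linarith
  · have hev : ∀ᶠ x' in nhds x, b x' = 0 := by
      have h2 : (closure {x' | x' ∈ U ∧ b x' ≠ 0})ᶜ ∈ nhds x := isClosed_closure.isOpen_compl.mem_nhds hcl
      filter_upwards [h2, H.hU.mem_nhds hx] with x' hx' hxU
      by_contra hne
      exact hx' (subset_closure ⟨hxU, hne⟩)
    have hb0 : b x = 0 := hev.self_of_nhds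
    have hpd : ∀ i k, pd k (fun x => b x i) x = 0 := by
      intro i k
      have : (fun x => b x i) =ᶠ[nhds x] fun _ => 0 := by
        filter_upwards [hev] with x' hx'; rw [hx']; rfl
      rw [pd, this.fderiv_eq]; simp
    have he : ∀ y, e00 a b x y = 0 := by
      intro y
      simp [e00, Bx, hpd, up, hb0, rbeta]
    rw [he, he]; ring
end iso

section vol
variable {n : ℕ} {a : Vec n → Matrix (Fin n) (Fin n) ℝ} {b : Vec n → Vec n} {U : Set (Vec n)}

open scoped MatrixOrder in
lemma exists_factor {Q : Matrix (Fin n) (Fin n) ℝ} (hQ : Q.PosSemidef) :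
    ∃ L : Matrix (Fin n) (Fin n) ℝ, Q = Lᵀ * L := by
  obtain ⟨B, hB⟩ := CStarAlgebra.nonneg_iff_eq_star_mul_self.mp hQ.nonneg
  exact ⟨B, by rw [hB, star_eq_conjTranspose]; simp⟩

lemma vol_ball_pos : (volume {y : Vec n | ∑ i, (y i) ^ 2 < 1}).toReal ≠ 0 := by
  have ho : IsOpen {y : Vec n | ∑ i, (y i) ^ 2 < 1} := isOpen_lt (by fun_prop) continuous_const
  have hne : ({y : Vec n | ∑ i, (y i) ^ 2 < 1}).Nonempty := ⟨0, by simp⟩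
  have hb : Bornology.IsBounded {y : Vec n | ∑ i, (y i) ^ 2 < 1} := by
    refine (Metric.isBounded_closedBall (x := (0 : Vec n)) (r := 1)).subset fun y hy => ?_
    rw [mem_closedBall_zero_iff, pi_norm_le_iff_of_nonneg zero_le_one]
    intro i
    have h1 : y i ^ 2 ≤ ∑ i, (y i) ^ 2 :=
      Finset.single_le_sum (f := fun i => (y i) ^ 2) (fun i _ => sq_nonneg _) (Finset.mem_univ i)
    have h2 : ∑ i, (y i) ^ 2 < 1 := hy
    rw [Real.norm_eq_abs]
    exact (sq_le_one_iff_abs_le_one _).mp (by linarith)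
  exact (ENNReal.toReal_pos (ho.measure_pos volume hne).ne' hb.measure_lt_top.ne).ne'

lemma RD.beta_B (H : RD a b U) {x : Vec n} (hx : x ∈ U) : rbeta b x (up a x (b x)) = bnormsq a b x := by
  rw [bnormsq_eq]; rfl

lemma RD.A_B (H : RD a b U) {x : Vec n} (hx : x ∈ U) (z : Vec n) :
    ∑ i, ∑ j, a x i j * z i * up a x (b x) j = rbeta b x z := by
  rw [rbeta]
  refine Finset.sum_congr rfl fun i _ => ?_
  rw [← H.a_up hx (b x) i, Finset.sum_mul]
  exact Finset.sum_congr rfl fun j _ => by ring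

lemma RD.A_B' (H : RD a b U) {x : Vec n} (hx : x ∈ U) (z : Vec n) :
    ∑ i, ∑ j, a x i j * up a x (b x) i * z j = rbeta b x z := by
  rw [← H.A_B hx z, Finset.sum_comm]
  refine Finset.sum_congr rfl fun i _ => Finset.sum_congr rfl fun j _ => ?_
  rw [H.symm x hx]; ring

lemma RD.qf_B (H : RD a b U) {x : Vec n} (hx : x ∈ U) :
    qf a b x (up a x (b x)) = bnormsq a b x * (1 - bnormsq a b x) := by
  rw [qf, H.A_B hx, H.beta_B hx]; ring

lemma RD.pol_qf_B (H : RD a b U) {x : Vec n} (hx : x ∈ U) (y : Vec n) :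
    pol (qf a b x) y (up a x (b x)) = 2 * (1 - bnormsq a b x) * rbeta b x y := by
  have h1 : ∑ i, ∑ j, a x i j * (y + up a x (b x)) i * (y + up a x (b x)) j =
      (∑ i, ∑ j, a x i j * y i * y j) + (∑ i, ∑ j, a x i j * y i * up a x (b x) j)
      + (∑ i, ∑ j, a x i j * up a x (b x) i * y j)
      + ∑ i, ∑ j, a x i j * up a x (b x) i * up a x (b x) j := by
    simp_rw [← Finset.sum_add_distrib]
    refine Finset.sum_congr rfl fun i _ => Finset.sum_congr rfl fun j _ => ?_
    simp only [Pi.add_apply]; ring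
  have h2 : rbeta b x (y + up a x (b x)) = rbeta b x y + bnormsq a b x := by
    have := (isL_beta (b := b) x).lin y (up a x (b x)) 1 1
    rw [one_smul, one_smul, H.beta_B hx] at this
    rw [this]; ring
  rw [pol]
  simp only [qf]
  rw [h1, h2, H.A_B hx, H.A_B' hx, H.A_B hx, H.beta_B hx]; ring

lemma RD.set_eq (H : RD a b U) {x : Vec n} (hx : x ∈ U) (y : Vec n) :
    RF a b x y < 1 ↔
      (1 - bnormsq a b x) * qf a b x (y + (1 - bnormsq a b x)⁻¹ • up a x (b x)) < 1 := by
  have hk : 0 < 1 - bnormsq a b x := by have := H.b2 x hx; linarith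
  have h1 := (isQ_qf (a := a) (b := b) x).line y (up a x (b x)) 1 (1 - bnormsq a b x)⁻¹
  rw [one_smul, H.pol_qf_B hx, H.qf_B hx] at h1
  have h2 : (1 - bnormsq a b x) * qf a b x (y + (1 - bnormsq a b x)⁻¹ • up a x (b x)) =
      (1 - bnormsq a b x) * (qf a b x y + 2 * rbeta b x y) + bnormsq a b x := by
    rw [h1]; field_simp
  rw [h2]
  have h3 : (1 - bnormsq a b x) * (qf a b x y + 2 * rbeta b x y) + bnormsq a b x < 1 ↔
      qf a b x y + 2 * rbeta b x y < 1 := by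
    constructor
    · intro h
      by_contra hc
      push Not at hc
      nlinarith
    · intro h; nlinarith
  rw [h3]
  by_cases hy : y = 0
  · subst hy; simp [RF, qf, rbeta, ralpha]
  rw [H.qf_eq hx hy]
  have h4 := abs_lt.mp (H.beta_lt hx hy)
  have h5 := H.apos hx hy
  simp only [RF]
  constructor
  · intro h; nlinarith
  · intro h
    by_contra hc
    push Not at hc
    nlinarith

lemma RD.det_q (H : RD a b U) {x : Vec n} (hx : x ∈ U) :
    (a x - vecMulVec (b x) (b x)).det = (a x).det * (1 - bnormsq a b x) := by
  have h := Matrix.det_add_replicateCol_mul_replicateRow (ι := Unit) (H.det_pos hx).ne'.isUnit (-b x) (b x)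
  have e1 : a x + replicateCol Unit (-b x) * replicateRow Unit (b x) = a x - vecMulVec (b x) (b x) := by
    ext i j; simp [Matrix.mul_apply, vecMulVec_apply]; ring
  rw [e1] at h
  rw [h]
  congr 1
  rw [Matrix.det_unique]
  simp only [Matrix.add_apply, Matrix.one_apply_eq, Matrix.mul_apply, replicateRow_apply,
    replicateCol_apply, Pi.neg_apply, bnormsq, Finset.sum_mul]
  rw [sub_eq_add_neg, ← Finset.sum_neg_distrib, Finset.sum_comm]
  congr 1
  refine Finset.sum_congr rfl fun i _ => ?_
  rw [← Finset.sum_neg_distrib]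
  exact Finset.sum_congr rfl fun j _ => by ring

lemma RD.log_sigma (H : RD a b U) {x : Vec n} (hx : x ∈ U) :
    Real.log (sigmaBH (RF a b) x) =
      (1/2) * (((n : ℝ) + 1) * Real.log (1 - bnormsq a b x) + Real.log (a x).det) := by
  have hk : 0 < 1 - bnormsq a b x := by have := H.b2 x hx; linarith
  have hd := H.det_pos hx
  set k := 1 - bnormsq a b x with hkd
  set Q : Matrix (Fin n) (Fin n) ℝ := k • (a x - vecMulVec (b x) (b x)) with hQ
  have hQz : ∀ z : Vec n, z ⬝ᵥ (Q *ᵥ z) = k * qf a b x z := by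
    intro z
    rw [hQ, smul_mulVec, dotProduct_smul, sub_mulVec, dotProduct_sub, smul_eq_mul, qf]
    congr 2
    · simp only [dotProduct, mulVec, Finset.mul_sum]
      exact Finset.sum_congr rfl fun i _ => Finset.sum_congr rfl fun j _ => by ring
    · simp only [rbeta, dotProduct, mulVec, Finset.mul_sum, Finset.sum_mul, vecMulVec_apply]
      rw [Finset.sum_comm]
      exact Finset.sum_congr rfl fun i _ => Finset.sum_congr rfl fun j _ => by ring
  have hQp : Q.PosSemidef := by
    refine Matrix.PosSemidef.of_dotProduct_mulVec_nonneg ?_ fun z => ?_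
    · ext i j
      simp only [hQ, conjTranspose_apply, Matrix.smul_apply, Matrix.sub_apply, vecMulVec_apply, star_trivial]
      rw [H.symm x hx j i]; ring_nf
    · rw [star_trivial, hQz]
      by_cases hz : z = 0
      · subst hz; simp [qf, rbeta]
      · exact mul_nonneg hk.le (H.qf_pos hx hz).le
  obtain ⟨L, hL⟩ := exists_factor hQp
  have hdet : L.det ^ 2 = k ^ (n + 1) * (a x).det := by
    have h1 := congrArg Matrix.det hL
    rw [Matrix.det_mul, Matrix.det_transpose, hQ, Matrix.det_smul, H.det_q hx] at h1
    rw [sq, ← h1, Fintype.card_fin]; ring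
  have hLne : L.det ≠ 0 := by
    intro h0; rw [h0] at hdet
    have : 0 < k ^ (n + 1) * (a x).det := by positivity
    norm_num at hdet
    rcases hdet with h | h
    · exact hk.ne' h
    · exact hd.ne' h
  have hset : {y : Vec n | RF a b x y < 1} =
      (fun y => y + k⁻¹ • up a x (b x)) ⁻¹' ((Matrix.toLin' L) ⁻¹' {y : Vec n | ∑ i, (y i) ^ 2 < 1}) := by
    ext y
    simp only [Set.mem_setOf_eq, Set.mem_preimage, Matrix.toLin'_apply]
    rw [H.set_eq hx, ← hQz, hL, ← Matrix.mulVec_mulVec, Matrix.dotProduct_mulVec, Matrix.vecMul_transpose]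
    simp only [dotProduct, sq]
    rfl
  have hsig : sigmaBH (RF a b) x = |L.det| := by
    rw [sigmaBH, hset, measure_preimage_add_right,
      Measure.addHaar_preimage_linearMap volume (by rwa [LinearMap.det_toLin']),
      LinearMap.det_toLin', ENNReal.toReal_mul, ENNReal.toReal_ofReal (abs_nonneg _)]
    have := vol_ball_pos (n := n)
    rw [abs_inv]
    have h2 : |L.det| ≠ 0 := abs_ne_zero.mpr hLne
    field_simp
  rw [hsig, Real.log_abs]
  have h3 := congrArg Real.log hdet
  rw [Real.log_pow, Real.log_mul (by positivity) hd.ne', Real.log_pow] at h3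
  push_cast at h3
  linarith
end vol

section fin
variable {n : ℕ} {a : Vec n → Matrix (Fin n) (Fin n) ℝ} {b : Vec n → Vec n} {U : Set (Vec n)}

lemma RD.diff (H : RD a b U) {f : Vec n → ℝ} (hf : ContDiffOn ℝ ∞ f U) {x : Vec n} (hx : x ∈ U) :
    DifferentiableAt ℝ f x :=
  (hf.contDiffAt (H.hU.mem_nhds hx)).differentiableAt (by simp)

lemma RD.pd_symm (H : RD a b U) {x : Vec n} (hx : x ∈ U) (k i j : Fin n) :
    pd k (fun x => a x i j) x = pd k (fun x => a x j i) x :=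
  pd_congr k (by filter_upwards [H.hU.mem_nhds hx] with z hz using H.symm z hz i j)

lemma det_updateRow_sum (A : Matrix (Fin n) (Fin n) ℝ) (i : Fin n) (v : Fin n → ℝ) :
    (A.updateRow i v).det = ∑ j, v j * A.adjugate j i := by
  have := Matrix.cramer_transpose_apply A v i
  rw [← this, Matrix.cramer_eq_adjugate_mulVec, ← Matrix.adjugate_transpose]
  change ∑ j, A.adjugate j i * v j = _
  exact Finset.sum_congr rfl fun j _ => mul_comm _ _

lemma RD.pd_det (H : RD a b U) {x : Vec n} (hx : x ∈ U) (k : Fin n) :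
    pd k (fun x => (a x).det) x =
      (a x).det * ∑ i, ∑ j, (a x)⁻¹ i j * pd k (fun x => a x i j) x := by
  let f : ContinuousMultilinearMap ℝ (fun _ : Fin n => Vec n) ℝ :=
    ⟨(Matrix.detRowAlternating (n := Fin n) (R := ℝ)).toMultilinearMap,
      Continuous.matrix_det (A := fun A : Matrix (Fin n) (Fin n) ℝ => A) continuous_id⟩
  have h1 : HasFDerivAt (fun x => (fun i j => a x i j : Fin n → Fin n → ℝ))
      (ContinuousLinearMap.pi fun i => ContinuousLinearMap.pi fun j => fderiv ℝ (fun x => a x i j) x) x :=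
    hasFDerivAt_pi.mpr fun i => hasFDerivAt_pi.mpr fun j => (H.diff (H.ha i j) hx).hasFDerivAt
  have h2 := (f.hasFDerivAt (fun i j => a x i j)).comp x h1
  have h3 : HasFDerivAt (fun x => (a x).det) _ x := h2
  rw [pd, h3.fderiv]
  simp only [ContinuousLinearMap.comp_apply, ContinuousMultilinearMap.linearDeriv_apply]
  rw [Finset.mul_sum]
  refine Finset.sum_congr rfl fun i _ => ?_
  change ((a x).updateRow i (fun j => pd k (fun x => a x i j) x)).det = _
  rw [det_updateRow_sum, Finset.mul_sum]
  refine Finset.sum_congr rfl fun j _ => ?_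
  rw [H.inv_symm hx, Matrix.inv_def, Matrix.smul_apply, Ring.inverse_eq_inv', smul_eq_mul]
  field_simp [(H.det_pos hx).ne']

lemma RD.B_smooth (H : RD a b U) (l : Fin n) : ContDiffOn ℝ ∞ (fun x => up a x (b x) l) U :=
  ContDiffOn.sum fun i _ => (H.ainv_smooth l i).mul (H.hb i)

lemma RD.pd_b2 (H : RD a b U) {x : Vec n} (hx : x ∈ U) (k : Fin n) :
    pd k (bnormsq a b) x = 2 * (∑ i, pd k (fun x => b x i) x * up a x (b x) i)
      - ∑ i, ∑ j, pd k (fun x => a x i j) x * up a x (b x) i * up a x (b x) j := by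
  have hB := fun l => H.diff (H.B_smooth l) hx
  have hb := fun l => H.diff (H.hb l) hx
  have ha := fun i j => H.diff (H.ha i j) hx
  have e1 : pd k (bnormsq a b) x = ∑ i, (pd k (fun x => b x i) x * up a x (b x) i
      + b x i * pd k (fun x => up a x (b x) i) x) := by
    have : bnormsq a b = fun x => ∑ i, b x i * up a x (b x) i := by funext z; exact bnormsq_eq z
    rw [this, pd_sum _ k (fun i _ => (hb i).fun_mul (hB i))]
    exact Finset.sum_congr rfl fun i _ => pd_mul k (hb i) (hB i)
  have e2 : ∀ i, pd k (fun x => b x i) x = ∑ j, (pd k (fun x => a x i j) x * up a x (b x) j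
      + a x i j * pd k (fun x => up a x (b x) j) x) := by
    intro i
    have : pd k (fun x => b x i) x = pd k (fun x => ∑ j, a x i j * up a x (b x) j) x :=
      pd_congr k (by filter_upwards [H.hU.mem_nhds hx] with z hz using (H.a_up hz (b z) i).symm)
    rw [this, pd_sum _ k (fun j _ => (ha i j).fun_mul (hB j))]
    exact Finset.sum_congr rfl fun j _ => pd_mul k (ha i j) (hB j)
  have e3 : ∑ i, pd k (fun x => b x i) x * up a x (b x) i =
      (∑ i, ∑ j, pd k (fun x => a x i j) x * up a x (b x) i * up a x (b x) j)
      + ∑ i, b x i * pd k (fun x => up a x (b x) i) x := by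
    have e4 : ∀ j, b x j = ∑ i, a x i j * up a x (b x) i := fun j => by
      refine (H.a_up hx (b x) j).symm.trans ?_
      exact Finset.sum_congr rfl fun i _ => by rw [H.symm x hx]
    have e5 : ∑ i, b x i * pd k (fun x => up a x (b x) i) x
       = ∑ i, ∑ j, a x i j * up a x (b x) i * pd k (fun x => up a x (b x) j) x := by
      rw [Finset.sum_comm]
      refine Finset.sum_congr rfl fun j _ => ?_
      conv_lhs => rw [e4 j]
      rw [Finset.sum_mul]
    rw [e5, ← Finset.sum_add_distrib]
    refine Finset.sum_congr rfl fun i _ => ?_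
    rw [e2 i, Finset.sum_mul, ← Finset.sum_add_distrib]
    exact Finset.sum_congr rfl fun j _ => by ring
  rw [e1, Finset.sum_add_distrib]
  linarith

lemma pd_lin (w : Fin n → ℝ) (k : Fin n) (y : Vec n) : pd k (fun y : Vec n => ∑ i, w i * y i) y = w k := by
  have hd : ∀ i, DifferentiableAt ℝ (fun y : Vec n => y i) y := fun i => by fun_prop
  have hc : ∀ i, DifferentiableAt ℝ (fun _ : Vec n => w i) y := fun i => by fun_prop
  rw [pd_sum _ k (fun i _ => (hc i).fun_mul (hd i))]
  have : ∀ i, pd k (fun y : Vec n => w i * y i) y = w i * if i = k then 1 else 0 := fun i => by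
    rw [pd_mul k (hc i) (hd i), pd_const, pd_coord]; ring
  simp [this]

lemma pd_quad (w : Fin n → Fin n → ℝ) (k : Fin n) (y : Vec n) :
    pd k (fun y : Vec n => ∑ i, ∑ j, w i j * y i * y j) y = ∑ j, (w k j + w j k) * y j := by
  have hd : ∀ i, DifferentiableAt ℝ (fun y : Vec n => y i) y := fun i => by fun_prop
  have hL : ∀ i, DifferentiableAt ℝ (fun y : Vec n => ∑ j, w i j * y j) y := fun i => by fun_prop
  have e : (fun y : Vec n => ∑ i, ∑ j, w i j * y i * y j) = fun y => ∑ i, (∑ j, w i j * y j) * y i := by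
    funext y; refine Finset.sum_congr rfl fun i _ => ?_
    rw [Finset.sum_mul]; exact Finset.sum_congr rfl fun j _ => by ring
  rw [e, pd_sum _ k (fun i _ => (hL i).fun_mul (hd i))]
  have : ∀ i, pd k (fun y : Vec n => (∑ j, w i j * y j) * y i) y
      = w i k * y i + (∑ j, w i j * y j) * if i = k then 1 else 0 := fun i => by
    rw [pd_mul k (hL i) (hd i), pd_lin, pd_coord]
  simp only [this, Finset.sum_add_distrib, mul_ite, mul_one, mul_zero, Finset.sum_ite_eq',
    Finset.mem_univ, if_true, add_mul]
  ring

lemma dy_Gl (l k : Fin n) (x y : Vec n) : dy k (Gl a l) x y =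
    ∑ j, (1/2) * (pd j (fun x => a x l k) x + pd k (fun x => a x l j) x
      - (1/2) * (pd l (fun x => a x k j) x + pd l (fun x => a x j k) x)) * y j := by
  have : Gl a l x = fun y => ∑ i, ∑ j, ((1/2) * (pd j (fun x => a x l i) x
      - (1/2) * pd l (fun x => a x i j) x)) * y i * y j := by
    funext y
    simp only [Gl, Ax, Finset.mul_sum, Finset.sum_mul, mul_sub]
    rw [Finset.sum_comm (f := fun m j => 1 / 2 * (pd m (fun x => a x l j) x * y j * y m))]
    simp_rw [← Finset.sum_sub_distrib]
    exact Finset.sum_congr rfl fun i _ => Finset.sum_congr rfl fun j _ => by ring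
  rw [dy, this, pd_quad]
  exact Finset.sum_congr rfl fun j _ => by ring

lemma dy_sl (l k : Fin n) (x y : Vec n) : dy k (sl b l) x y =
    (1/2) * (pd k (fun x => b x l) x - pd l (fun x => b x k) x) := by
  have : sl b l x = fun y => ∑ i, ((1/2) * (pd i (fun x => b x l) x - pd l (fun x => b x i) x)) * y i := by
    funext y
    simp only [sl, Bx, Finset.mul_sum, mul_sub]
    simp_rw [← Finset.sum_sub_distrib]
    exact Finset.sum_congr rfl fun i _ => by ring
  rw [dy, this, pd_lin]

lemma RD.Dh_eq (H : RD a b U) {x y : Vec n} (hx : x ∈ U) (hy : y ≠ 0) :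
    Dh a b x y = (1/2) * (∑ k, y k * ∑ i, ∑ j, (a x)⁻¹ i j * pd k (fun x => a x i j) x)
      - ((n : ℝ) + 1) * s0 a b x y := by
  have sG := fun l => (Reg.Gl H l).sm H
  have ss := fun l => (Reg.sl H l).sm H
  have sα := H.smAlpha
  have s0s := (Reg.s0 H).sm H
  have sI := fun i j => Sm.coef (H.ainv_smooth i j)
  have e1 : ∀ m, dy m (Gh a b m) x y = (∑ l, (a x)⁻¹ m l * (dy m (Gl a l) x y
      + (yl a m x y * (ralpha a x y)⁻¹ * sl b l x y + ralpha a x y * dy m (sl b l) x y)))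
      - (dy m (s0 a b) x y * y m + s0 a b x y) := by
    intro m
    have : Gh a b m = fun x y => (∑ l, (a x)⁻¹ m l * (Gl a l x y + ralpha a x y * sl b l x y))
        + (-1) * (s0 a b x y * y m) := by
      funext x y; simp only [Gh]; ring
    have sc : Sm U (fun _ _ => (-1 : ℝ)) := Sm.coef contDiffOn_const
    have sA : ∀ l, Sm U (fun x y => (a x)⁻¹ m l * (Gl a l x y + ralpha a x y * sl b l x y)) :=
      fun l => (sI m l).mul ((sG l).add (sα.mul (ss l)))
    rw [this, dy_add' H.hU (Sm.sum _ fun l _ => sA l) (sc.mul (s0s.mul (Sm.yc m))) m hx hy,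
      dy_sum' _ H.hU (fun l _ => sA l) m hx hy,
      dy_mul' H.hU sc (s0s.mul (Sm.yc m)) m hx hy, dy_mul' H.hU s0s (Sm.yc m) m hx hy,
      dy_coef (fun _ => (-1:ℝ)), dy_yc]
    have e2 : ∀ l, dy m (fun x y => (a x)⁻¹ m l * (Gl a l x y + ralpha a x y * sl b l x y)) x y
       = (a x)⁻¹ m l * (dy m (Gl a l) x y
      + (yl a m x y * (ralpha a x y)⁻¹ * sl b l x y + ralpha a x y * dy m (sl b l) x y)) := by
      intro l
      rw [dy_mul' H.hU (sI m l) ((sG l).add (sα.mul (ss l))) m hx hy,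
        dy_add' H.hU (sG l) (sα.mul (ss l)) m hx hy, dy_mul' H.hU sα (ss l) m hx hy,
        dy_alpha H m x hx y hy, dy_coef (fun x => (a x)⁻¹ m l)]
      ring
    simp_rw [e2]
    simp; ring
  have e3 : ∑ m, ∑ l, (a x)⁻¹ m l * dy m (Gl a l) x y
      = (1/2) * (∑ k, y k * ∑ i, ∑ j, (a x)⁻¹ i j * pd k (fun x => a x i j) x) := by
    have t : ∑ m, ∑ l, (a x)⁻¹ m l * dy m (Gl a l) x y
       = ∑ m, ∑ l, (a x)⁻¹ m l * (∑ j, (1/2) * (pd j (fun x => a x m l) x) * y j)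
        + ((∑ m, ∑ l, (a x)⁻¹ m l * (∑ j, (1/2) * (pd m (fun x => a x l j) x) * y j))
        - ∑ m, ∑ l, (a x)⁻¹ m l * (∑ j, (1/2) * (pd l (fun x => a x m j) x) * y j)) := by
      simp_rw [← Finset.sum_sub_distrib, ← Finset.sum_add_distrib, ← mul_sub, ← mul_add]
      refine Finset.sum_congr rfl fun m _ => Finset.sum_congr rfl fun l _ => ?_
      congr 1
      rw [dy_Gl, ← Finset.sum_sub_distrib, ← Finset.sum_add_distrib]
      refine Finset.sum_congr rfl fun j _ => ?_
      rw [H.pd_symm hx l j m, H.pd_symm hx j l m]; ring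
    have t2 : (∑ m, ∑ l, (a x)⁻¹ m l * (∑ j, (1/2) * (pd m (fun x => a x l j) x) * y j))
        = ∑ m, ∑ l, (a x)⁻¹ m l * (∑ j, (1/2) * (pd l (fun x => a x m j) x) * y j) := by
      rw [Finset.sum_comm]
      exact Finset.sum_congr rfl fun m _ => Finset.sum_congr rfl fun l _ => by rw [H.inv_symm hx]
    rw [t, t2, sub_self, add_zero]
    simp_rw [Finset.mul_sum]
    rw [Finset.sum_comm_cycle]
    exact Finset.sum_congr rfl fun m _ => Finset.sum_congr rfl fun l _ =>
      Finset.sum_congr rfl fun j _ => by ring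
  have e4 : ∑ m, ∑ l, (a x)⁻¹ m l * (yl a m x y * (ralpha a x y)⁻¹ * sl b l x y) = 0 := by
    have := H.yl_up hx y (fun l => sl b l x y)
    rw [y_sl] at this
    have h2 : ∑ m, ∑ l, (a x)⁻¹ m l * (yl a m x y * (ralpha a x y)⁻¹ * sl b l x y)
        = (ralpha a x y)⁻¹ * ∑ i, yl a i x y * up a x (fun l => sl b l x y) i := by
      simp_rw [up, Finset.mul_sum]
      exact Finset.sum_congr rfl fun m _ => Finset.sum_congr rfl fun l _ => by ring
    rw [h2, this, mul_zero]
  have e5 : ∑ m, ∑ l, (a x)⁻¹ m l * (ralpha a x y * dy m (sl b l) x y) = 0 := by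
    have h : ∑ m, ∑ l, (a x)⁻¹ m l * (ralpha a x y * dy m (sl b l) x y)
       = - ∑ m, ∑ l, (a x)⁻¹ m l * (ralpha a x y * dy m (sl b l) x y) := by
      conv_lhs => rw [Finset.sum_comm]
      simp_rw [← Finset.sum_neg_distrib]
      refine Finset.sum_congr rfl fun m _ => Finset.sum_congr rfl fun l _ => ?_
      rw [H.inv_symm hx, dy_sl, dy_sl]; ring
    linarith
  have e6 := (Reg.s0 H).euler H hx hy
  simp only [Dh, e1, mul_add, Finset.sum_add_distrib, Finset.sum_sub_distrib, e3, e4, e5, e6]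
  simp
  ring

end fin

section fin2
variable {n : ℕ} {a : Vec n → Matrix (Fin n) (Fin n) ℝ} {b : Vec n → Vec n} {U : Set (Vec n)}

lemma isL_add {f : Vec n → ℝ} (h : IsL f) (u v : Vec n) : f (u + v) = f u + f v := by
  obtain ⟨w, hw⟩ := h
  simp [hw, mul_add, Finset.sum_add_distrib]

lemma B_pol_Gl (H : RD a b U) {x : Vec n} (hx : x ∈ U) (y B : Vec n) :
    ∑ l, B l * pol (Gl a l x) y B =
      (1/2) * ∑ m, y m * ∑ i, ∑ j, pd m (fun x => a x i j) x * B i * B j := by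
  have h1 : ∀ l, pol (Gl a l x) y B = (1/2) * ((∑ m, ∑ j, pd m (fun x => a x l j) x * y j * B m)
      + (∑ m, ∑ j, pd m (fun x => a x l j) x * B j * y m)
      - ∑ i, ∑ j, pd l (fun x => a x i j) x * y i * B j) := by
    intro l
    have e : ∑ i, ∑ j, pd l (fun x => a x i j) x * B i * y j
        = ∑ i, ∑ j, pd l (fun x => a x i j) x * y i * B j := by
      rw [Finset.sum_comm]
      exact Finset.sum_congr rfl fun i _ => Finset.sum_congr rfl fun j _ => by
        rw [H.pd_symm hx]; ring
    have e2 : pol (Gl a l x) y B = (1/2) * ((∑ m, ∑ j, pd m (fun x => a x l j) x * y j * B m)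
      + (∑ m, ∑ j, pd m (fun x => a x l j) x * B j * y m)
      - (1/2) * ((∑ i, ∑ j, pd l (fun x => a x i j) x * y i * B j)
        + ∑ i, ∑ j, pd l (fun x => a x i j) x * B i * y j)) := by
      simp only [pol, Gl, Ax, Finset.sum_mul, Finset.mul_sum, ← Finset.sum_add_distrib,
        ← Finset.sum_sub_distrib]
      exact Finset.sum_congr rfl fun i _ => Finset.sum_congr rfl fun j _ => by
        simp only [Pi.add_apply]; ring
    rw [e2, e]; ring
  have h2 : ∑ l, B l * (∑ m, ∑ j, pd m (fun x => a x l j) x * y j * B m)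
      = ∑ l, B l * ∑ i, ∑ j, pd l (fun x => a x i j) x * y i * B j := by
    simp_rw [Finset.mul_sum]
    rw [Finset.sum_comm]
    refine Finset.sum_congr rfl fun m _ => ?_
    rw [Finset.sum_comm]
    exact Finset.sum_congr rfl fun i _ => Finset.sum_congr rfl fun j _ => by
        rw [H.pd_symm hx]; ring
  have h3 : ∑ l, B l * (∑ m, ∑ j, pd m (fun x => a x l j) x * B j * y m)
      = ∑ m, y m * ∑ i, ∑ j, pd m (fun x => a x i j) x * B i * B j := by
    simp_rw [Finset.mul_sum]
    rw [Finset.sum_comm]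
    exact Finset.sum_congr rfl fun m _ => Finset.sum_congr rfl fun i _ => 
      Finset.sum_congr rfl fun j _ => by ring
  rw [← h3]
  have h4 : ∑ l, B l * pol (Gl a l x) y B = (1/2) *
      ((∑ l, B l * (∑ m, ∑ j, pd m (fun x => a x l j) x * y j * B m))
      + (∑ l, B l * (∑ m, ∑ j, pd m (fun x => a x l j) x * B j * y m))
      - ∑ l, B l * ∑ i, ∑ j, pd l (fun x => a x i j) x * y i * B j) := by
    rw [← Finset.sum_add_distrib, ← Finset.sum_sub_distrib, Finset.mul_sum]
    exact Finset.sum_congr rfl fun l _ => by rw [h1]; ring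
  rw [h4, h2]; ring

lemma pol_e00 (H : RD a b U) {x : Vec n} (hx : x ∈ U) (y : Vec n) :
    pol (e00 a b x) y (up a x (b x)) = (∑ k, y k * pd k (bnormsq a b) x)
      - 2 * (1 - bnormsq a b x) * s0 a b x y := by
  have hB := B_pol_Gl H hx y (up a x (b x))
  have hβ := H.beta_B hx
  have hs : s0 a b x (up a x (b x)) = 0 := y_sl x (up a x (b x))
  have hD : ∑ k, y k * pd k (bnormsq a b) x = 2 * (∑ k, y k * Bx b k x (up a x (b x)))
      - ∑ m, y m * ∑ i, ∑ j, pd m (fun x => a x i j) x * up a x (b x) i * up a x (b x) j := by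
    rw [Finset.mul_sum, ← Finset.sum_sub_distrib]
    exact Finset.sum_congr rfl fun k _ => by rw [H.pd_b2 hx k]; simp only [Bx]; ring
  have hs0 : 2 * s0 a b x y = (∑ k, y k * Bx b k x (up a x (b x)))
      - ∑ l, up a x (b x) l * Bx b l x y := by
    have : ∑ k, y k * Bx b k x (up a x (b x))
        = ∑ l, up a x (b x) l * ∑ m, pd m (fun x => b x l) x * y m := by
      simp_rw [Bx, Finset.mul_sum]
      rw [Finset.sum_comm]
      exact Finset.sum_congr rfl fun i _ => Finset.sum_congr rfl fun j _ => by ring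
    rw [this, ← Finset.sum_sub_distrib, s0, Finset.mul_sum]
    exact Finset.sum_congr rfl fun l _ => by rw [sl]; ring
  have p1 : ∀ B : Vec n, pol (e00 a b x) y B = (∑ k, y k * Bx b k x B) + (∑ l, B l * Bx b l x y)
      - 2 * (∑ l, up a x (b x) l * pol (Gl a l x) y B)
      + 2 * (rbeta b x y * s0 a b x B + rbeta b x B * s0 a b x y) := by
    intro B
    have q1 : ∑ m, Bx b m x (y + B) * (y + B) m = (∑ m, Bx b m x y * y m) + (∑ m, Bx b m x B * B m)
        + (∑ k, y k * Bx b k x B) + (∑ l, B l * Bx b l x y) := by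
      simp_rw [← Finset.sum_add_distrib]
      exact Finset.sum_congr rfl fun m _ => by
        rw [isL_add (isL_Bx x m), Pi.add_apply]; ring
    have q2 : ∑ l, up a x (b x) l * pol (Gl a l x) y B = (∑ l, up a x (b x) l * Gl a l x (y + B))
        - (∑ l, up a x (b x) l * Gl a l x y) - ∑ l, up a x (b x) l * Gl a l x B := by
      simp_rw [← Finset.sum_sub_distrib]
      exact Finset.sum_congr rfl fun m _ => by rw [pol]; ring
    rw [q2]
    simp only [pol, e00, q1, isL_add (isL_beta x), isL_add (isL_s0 x)]
    ring
  rw [p1, hB, hβ, hs, hD]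
  linear_combination hs0

def cf (a : Vec n → Matrix (Fin n) (Fin n) ℝ) (b : Vec n → Vec n) (u x : Vec n) : ℝ :=
  e00 a b x u / (2 * qf a b x u)

lemma cf_smooth (H : RD a b U) {u : Vec n} (hu : u ≠ 0) : ContDiffOn ℝ ∞ (cf a b u) U := by
  have sq : Sm U (qf a b) := (H.smA.add (((Sm.coef contDiffOn_const :
    Sm U (fun _ _ => (-1 : ℝ))).mul (H.smBeta.mul H.smBeta)))).congr
      (fun x _ y _ => by simp only [qf]; ring)
  have hm : ContDiffOn ℝ ∞ (fun x : Vec n => (x, u)) U := by fun_prop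
  have key : ∀ f : Vec n → Vec n → ℝ, Sm U f → ContDiffOn ℝ ∞ (fun x => f x u) U := fun f hf =>
    ContDiffOn.comp (g := fun p : Vec n × Vec n => f p.1 p.2) hf hm (fun x hx => ⟨hx, hu⟩)
  exact (key _ ((Reg.e00 H).sm H)).div (contDiffOn_const.mul (key _ sq))
    (fun x hx => (mul_pos two_pos (H.qf_pos hx hu)).ne')

lemma RD.pd_log (H : RD a b U) {x : Vec n} (hx : x ∈ U) (k : Fin n) :
    pd k (fun x' => Real.log (sigmaBH (RF a b) x')) x =
      (1/2) * (((n : ℝ) + 1) * (-(1 - bnormsq a b x)⁻¹ * pd k (bnormsq a b) x)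
        + ∑ i, ∑ j, (a x)⁻¹ i j * pd k (fun x => a x i j) x) := by
  have hk : 0 < 1 - bnormsq a b x := by have := H.b2 x hx; linarith
  have hd := H.det_pos hx
  have e : pd k (fun x' => Real.log (sigmaBH (RF a b) x')) x = pd k (fun x' =>
      (1/2) * (((n : ℝ) + 1) * Real.log (1 - bnormsq a b x') + Real.log (a x').det)) x :=
    pd_congr k (by filter_upwards [H.hU.mem_nhds hx] with z hz using H.log_sigma hz)
  have db := H.diff H.b2_smooth hx
  have dd := H.diff (det_smooth H.ha) hx
  have d1 : HasDerivAt (fun t : ℝ => Real.log (1 - t)) (-(1 - bnormsq a b x)⁻¹) (bnormsq a b x) := by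
    have := ((hasDerivAt_id (bnormsq a b x)).const_sub 1).log hk.ne'
    rw [neg_div, one_div] at this
    exact this
  have h1 := pd_comp k db d1
  have h2 := pd_comp k dd (Real.hasDerivAt_log hd.ne')
  have f1 : DifferentiableAt ℝ (fun z => Real.log (1 - bnormsq a b z)) x :=
    d1.differentiableAt.comp x db
  have f2 : DifferentiableAt ℝ (fun z => Real.log (a z).det) x := dd.log hd.ne'
  have c1 : ∀ c : ℝ, DifferentiableAt ℝ (fun _ : Vec n => c) x := fun c => by fun_prop
  rw [e, pd_mul k (c1 _) (((c1 _).fun_mul f1).fun_add f2), pd_add k ((c1 _).fun_mul f1) f2,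
    pd_mul k (c1 _) f1, h1, h2, H.pd_det hx, pd_const, pd_const]
  rw [← mul_assoc (a x).det⁻¹, inv_mul_cancel₀ hd.ne']
  ring

lemma RD.S_eq (H : RD a b U) {x y u : Vec n} (hx : x ∈ U) (hy : y ≠ 0) (hu : u ≠ 0)
    (hiso : ∀ y z : Vec n, y ≠ 0 → z ≠ 0 → e00 a b x y * qf a b x z = e00 a b x z * qf a b x y) :
    SCurv (RF a b) x y = ((n : ℝ) + 1) * cf a b u x * RF a b x y := by
  have hk : 0 < 1 - bnormsq a b x := by have := H.b2 x hx; linarith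
  have hqu := H.qf_pos hx hu
  have hc : ∀ z, e00 a b x z = 2 * cf a b u x * qf a b x z := by
    intro z
    by_cases hz : z = 0
    · subst hz
      obtain ⟨w, hw⟩ := isQ_e00 (a := a) (b := b) x
      obtain ⟨v, hv⟩ := isQ_qf (a := a) (b := b) x
      rw [hw, hv]; simp
    · have := hiso z u hz hu
      rw [cf]; field_simp; linarith
  have hp : pol (e00 a b x) y (up a x (b x)) =
      2 * cf a b u x * pol (qf a b x) y (up a x (b x)) := by
    simp only [pol, hc]; ring
  rw [pol_e00 H hx, H.pol_qf_B hx] at hp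
  have hdiv := divG H x hx y hy
  beta_reduce at hdiv
  have hF := H.Fne x hx y hy
  have hP : Pp a b x y = cf a b u x * (ralpha a x y - rbeta b x y) := by
    rw [Pp, hc, H.qf_eq hx hy]
    have : ralpha a x y ^ 2 - rbeta b x y ^ 2 = RF a b x y * (ralpha a x y - rbeta b x y) := by
      simp only [RF]; ring
    rw [this]; field_simp
  have hS : ∑ m, y m * pd m (fun x' => Real.log (sigmaBH (RF a b) x')) x =
      (1/2) * (((n : ℝ) + 1) * (-(1 - bnormsq a b x)⁻¹ * ∑ k, y k * pd k (bnormsq a b) x)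
        + ∑ k, y k * ∑ i, ∑ j, (a x)⁻¹ i j * pd k (fun x => a x i j) x) := by
    rw [Finset.mul_sum, Finset.mul_sum, ← Finset.sum_add_distrib, Finset.mul_sum]
    exact Finset.sum_congr rfl fun k _ => by rw [H.pd_log hx]; ring
  have hD : (1 - bnormsq a b x)⁻¹ * ∑ k, y k * pd k (bnormsq a b) x
      = 4 * cf a b u x * rbeta b x y + 2 * s0 a b x y := by
    rw [inv_mul_eq_iff_eq_mul₀ hk.ne']; linarith
  rw [SCurv, hdiv, hS, H.Dh_eq hx hy, hP, neg_mul, hD]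
  simp only [RF]; ring

end fin2

/-- **Theorem 1.1.** A Randers metric `F = α + β` of weakly isotropic scalar
curvature `r = n(n−1)(θ/F + μ)` is of isotropic S-curvature
`S = (n+1) c(x) F`. -/
theorem randers_weakly_isotropic_scalar_implies_isotropic_S_curvature
    {n : ℕ} (hn : 2 ≤ n)
    (U : Set (Vec n)) (hUopen : IsOpen U) (hUne : U.Nonempty)
    (a : Vec n → Matrix (Fin n) (Fin n) ℝ) (b : Vec n → Vec n)
    (hRanders : IsRandersOn a b U)
    (F : Vec n → Vec n → ℝ)
    (hFdef : ∀ x y, F x y = ralpha a x y + rbeta b x y)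
    (θ : Vec n → Vec n) (μ : Vec n → ℝ)
    (hθ : ContDiffOn ℝ (⊤ : ℕ∞) θ U) (hμ : ContDiffOn ℝ (⊤ : ℕ∞) μ U)
    (hwisc : ∀ x ∈ U, ∀ y : Vec n, y ≠ 0 →
      scalarCurv F x y =
        (n : ℝ) * ((n : ℝ) - 1) * ((∑ i, θ x i * y i) / F x y + μ x)) :
    ∃ c : Vec n → ℝ, ContDiffOn ℝ (⊤ : ℕ∞) c U ∧
      ∀ x ∈ U, ∀ y : Vec n, y ≠ 0 →
        SCurv F x y = ((n : ℝ) + 1) * c x * F x y := by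
  have hRF : F = RF a b := by funext x y; exact hFdef x y
  subst hRF
  obtain ⟨h1, h2, h3, h4, h5⟩ := hRanders
  have hpos : ∀ x ∈ U, ∀ y : Vec n, y ≠ 0 → 0 < ∑ i, ∑ j, a x i j * y i * y j := by
    intro x hx y hy
    have := (h3 x hx).2.1.dotProduct_mulVec_pos hy
    have e : star y ⬝ᵥ (a x *ᵥ y) = ∑ i, ∑ j, a x i j * y i * y j := by
      simp only [dotProduct, mulVec, star_trivial, Finset.mul_sum]
      exact Finset.sum_congr rfl fun i _ => Finset.sum_congr rfl fun j _ => by ring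
    rwa [e] at this
  have H : RD a b U :=
    { hU := hUopen
      ha := h1
      hb := fun i => contDiffOn_pi.mp h2 i
      symm := fun x hx i j => (h3 x hx).1.apply j i
      pos := hpos
      posdef := fun x hx => (h3 x hx).2.1
      b2 := fun x hx => (h3 x hx).2.2
      Fpos := fun x hx y hy => (h5 x hx y hy).1 }
  obtain ⟨g, hg, hge⟩ := e00_clear H θ μ (fun i => contDiffOn_pi.mp hθ i) hμ hwisc
  have hu : (Pi.single ⟨0, by omega⟩ 1 : Vec n) ≠ 0 := by simp
  exact ⟨cf a b (Pi.single ⟨0, by omega⟩ 1), cf_smooth H hu, fun x hx y hy =>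
    H.S_eq hx hy hu (iso_all hn H hg hge hx)⟩
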